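/- Let R be a commutative noetherian ring of finite Krull dimension and C a semidualizing R-module. Then every R-module admits a finite resolution by G_C-flat modules (i.e., for every R-module M there exist n and an exact sequence 0 → X_n → ⋯ → X_0 → M → 0 with each X_i G_C-flat) if and only if C is a dualizing module for R, i.e. C has finite injective dimension. -/

import Mathlib

open CategoryTheory TensorProduct

universe u

section
variable (R : Type u) [CommRing R]

def extZero (M N : ModuleCat.{u} R) : Prop :=
  ∀ i : ℕ, 1 ≤ i → Subsingleton (((Ext R (ModuleCat.{u} R) i).obj (Opposite.op M)).obj N)

def torZero (M N : ModuleCat.{u} R) : Prop :=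
  ∀ i : ℕ, 1 ≤ i → Subsingleton (((Tor (ModuleCat.{u} R) i).obj M).obj N)

def IsSemidualizing (C : ModuleCat.{u} R) : Prop :=
  Module.Finite R C ∧ Function.Bijective (LinearMap.lsmul R C) ∧ extZero R C C

/-- A module is `C`-flat if it is isomorphic to `F ⊗[R] C` with `F` flat. -/
def IsCFlat (C M : ModuleCat.{u} R) : Prop :=
  ∃ F : ModuleCat.{u} R, Module.Flat R F ∧ Nonempty (M ≃ₗ[R] (F ⊗[R] C))

def IsCInjective (C M : ModuleCat.{u} R) : Prop :=
  ∃ I : ModuleCat.{u} R, Module.Injective R I ∧ Nonempty (M ≃ₗ[R] (↥C →ₗ[R] ↥I))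

/-- cotorsion: `Ext^{≥1}(F, N) = 0` for all flat `F`. -/
def IsCotorsion (N : ModuleCat.{u} R) : Prop :=
  ∀ F : ModuleCat.{u} R, Module.Flat R F → extZero R F N

/-- `C`-cotorsion: `Ext^{≥1}(F ⊗ C, N) = 0` for all flat `F`. -/
def IsCCotorsion (C N : ModuleCat.{u} R) : Prop :=
  ∀ F : ModuleCat.{u} R, Module.Flat R F →
    extZero R (ModuleCat.of R (↥F ⊗[R] ↥C)) N

/-- `C`-flat `C`-cotorsion: isomorphic to `F ⊗ C` with `F` flat and cotorsion. -/
def IsCFlatCotorsion (C M : ModuleCat.{u} R) : Prop :=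
  ∃ F : ModuleCat.{u} R, Module.Flat R F ∧ IsCotorsion R F ∧
    Nonempty (M ≃ₗ[R] (F ⊗[R] C))

/-- The natural evaluation map `C ⊗ Hom(C,M) → M`. -/
noncomputable def evalMap (C M : ModuleCat.{u} R) :
    (↥C ⊗[R] (↥C →ₗ[R] ↥M)) →ₗ[R] ↥M :=
  TensorProduct.lift (LinearMap.id (R := R) (M := ↥C →ₗ[R] ↥M)).flip

/-- The Bass class `B_C(R)`. -/
noncomputable def InBassClass (C M : ModuleCat.{u} R) : Prop :=
  extZero R C M ∧
  torZero R C (ModuleCat.of R (↥C →ₗ[R] ↥M)) ∧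
  Function.Bijective (evalMap R C M)

/-- A `ℤ`-indexed complex of `R`-modules: `d i : X (i+1) → X i`. -/
structure ZComplex where
  X : ℤ → ModuleCat.{u} R
  d : ∀ i : ℤ, ↥(X (i + 1)) →ₗ[R] ↥(X i)
  d_comp_d : ∀ i : ℤ, (d i).comp (d (i + 1)) = 0

namespace ZComplex

variable {R} (Z : ZComplex R)

/-- Exactness of the complex. -/
def IsExact : Prop := ∀ i : ℤ, Function.Exact (Z.d (i + 1)) (Z.d i)

/-- Exactness of `Z ⊗[R] J`. -/
def TensorExact (J : ModuleCat.{u} R) : Prop :=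
  ∀ i : ℤ, Function.Exact (LinearMap.rTensor (↥J) (Z.d (i + 1)))
    (LinearMap.rTensor (↥J) (Z.d i))

/-- Exactness of `Hom_R(V, Z)`. -/
def HomFromExact (V : ModuleCat.{u} R) : Prop :=
  ∀ i : ℤ, Function.Exact
    (fun f : ↥V →ₗ[R] ↥(Z.X (i + 1 + 1)) => (Z.d (i + 1)).comp f)
    (fun f : ↥V →ₗ[R] ↥(Z.X (i + 1)) => (Z.d i).comp f)

/-- Exactness of `Hom_R(Z, V)`. -/
def HomToExact (V : ModuleCat.{u} R) : Prop :=
  ∀ i : ℤ, Function.Exact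
    (fun g : ↥(Z.X i) →ₗ[R] ↥V => g.comp (Z.d i))
    (fun g : ↥(Z.X (i + 1)) →ₗ[R] ↥V => g.comp (Z.d (i + 1)))

/-- `M ≅ Coker(∂₁)`. -/
def IsCokerOfD1 (M : ModuleCat.{u} R) : Prop :=
  Nonempty (↥M ≃ₗ[R] (↥(Z.X 0) ⧸ LinearMap.range (Z.d 0)))

end ZComplex

end

section
variable (R : Type u) [CommRing R]

/-- A complete `FF_C`-resolution witnessing that `M` is `G_C`-flat. -/
def IsGCFlat (C M : ModuleCat.{u} R) : Prop :=
  ∃ Z : ZComplex R, Z.IsExact ∧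
    (∀ i : ℤ, 0 ≤ i → Module.Flat R (Z.X i)) ∧
    (∀ i : ℤ, i < 0 → IsCFlat R C (Z.X i)) ∧
    (∀ J : ModuleCat.{u} R, IsCInjective R C J → Z.TensorExact J) ∧
    Z.IsCokerOfD1 M

def IsCProjective (C M : ModuleCat.{u} R) : Prop :=
  ∃ P : ModuleCat.{u} R, Module.Projective R P ∧ Nonempty (M ≃ₗ[R] (P ⊗[R] C))

/-- A complete `PP_C`-resolution witnessing that `M` is `G_C`-projective. -/
def IsGCProjective (C M : ModuleCat.{u} R) : Prop :=
  ∃ Z : ZComplex R, Z.IsExact ∧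
    (∀ i : ℤ, 0 ≤ i → Module.Projective R (Z.X i)) ∧
    (∀ i : ℤ, i < 0 → IsCProjective R C (Z.X i)) ∧
    (∀ Q : ModuleCat.{u} R, IsCProjective R C Q → Z.HomToExact Q) ∧
    Z.IsCokerOfD1 M

/-- `G(𝒳)` for a class `𝒳` of modules. -/
def GClass (𝒳 : ModuleCat.{u} R → Prop) (M : ModuleCat.{u} R) : Prop :=
  ∃ Z : ZComplex R, Z.IsExact ∧
    (∀ i : ℤ, 𝒳 (Z.X i)) ∧
    (∀ V : ModuleCat.{u} R, 𝒳 V → Z.HomFromExact V) ∧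
    (∀ V : ModuleCat.{u} R, 𝒳 V → Z.HomToExact V) ∧
    Z.IsCokerOfD1 M

/-- Iterates `G^n(𝒳)`, with `G^0(𝒳) = 𝒳`. -/
def GIter : ℕ → (ModuleCat.{u} R → Prop) → (ModuleCat.{u} R → Prop)
  | 0, 𝒳 => 𝒳
  | n + 1, 𝒳 => GClass R (GIter n 𝒳)

/-- `H_C(𝒳)`: modules with a `P_C F_C^cot`-complete `𝒳`-resolution. -/
def HClass (C : ModuleCat.{u} R) (𝒳 : ModuleCat.{u} R → Prop) (M : ModuleCat.{u} R) : Prop :=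
  ∃ Z : ZComplex R, Z.IsExact ∧
    (∀ i : ℤ, 𝒳 (Z.X i)) ∧
    (∀ P : ModuleCat.{u} R, Module.Projective R P →
      Z.HomFromExact (ModuleCat.of R (↥P ⊗[R] ↥C))) ∧
    (∀ N : ModuleCat.{u} R, IsCFlatCotorsion R C N → Z.HomToExact N) ∧
    Z.IsCokerOfD1 M

/-- Iterates `H_C^n(𝒳)`, with `H_C^0(𝒳) = 𝒳`. -/
def HIter (C : ModuleCat.{u} R) : ℕ → (ModuleCat.{u} R → Prop) → (ModuleCat.{u} R → Prop)
  | 0, 𝒳 => 𝒳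
  | n + 1, 𝒳 => HClass R C (HIter C n 𝒳)

/-- `M` admits a resolution `0 → X_n → ⋯ → X_0 → M → 0` with each `X_i` in `𝒳`. -/
def HasResOfLength (𝒳 : ModuleCat.{u} R → Prop) (n : ℕ) (M : ModuleCat.{u} R) : Prop :=
  ∃ (P : ℕ → ModuleCat.{u} R) (d : ∀ i : ℕ, ↥(P (i + 1)) →ₗ[R] ↥(P i))
    (ε : ↥(P 0) →ₗ[R] ↥M),
      Function.Surjective ε ∧ Function.Exact (d 0) ε ∧
      (∀ i : ℕ, Function.Exact (d (i + 1)) (d i)) ∧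
      (∀ i : ℕ, i ≤ n → 𝒳 (P i)) ∧
      (∀ i : ℕ, n < i → Subsingleton (P i))

/-- `M` admits a coresolution `0 → M → Y_0 → ⋯ → Y_n → 0` with each `Y_i` in `𝒳`. -/
def HasCoresOfLength (𝒳 : ModuleCat.{u} R → Prop) (n : ℕ) (M : ModuleCat.{u} R) : Prop :=
  ∃ (P : ℕ → ModuleCat.{u} R) (d : ∀ i : ℕ, ↥(P i) →ₗ[R] ↥(P (i + 1)))
    (η : ↥M →ₗ[R] ↥(P 0)),
      Function.Injective η ∧ Function.Exact η (d 0) ∧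
      (∀ i : ℕ, Function.Exact (d i) (d (i + 1))) ∧
      (∀ i : ℕ, i ≤ n → 𝒳 (P i)) ∧
      (∀ i : ℕ, n < i → Subsingleton (P i))

/-- `C` is a dualizing module: semidualizing of finite injective dimension. -/
def IsDualizing (C : ModuleCat.{u} R) : Prop :=
  IsSemidualizing R C ∧
  ∃ n : ℕ, HasCoresOfLength R (fun I => Module.Injective R ↥I) n C

end

section
variable {R : Type u} [CommRing R]

/-- `f` and `g` form a short exact sequence `0 → A → B → D → 0`. -/
structure IsShortExact {A B D : Type*} [AddCommGroup A] [AddCommGroup B] [AddCommGroup D]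
    [Module R A] [Module R B] [Module R D] (f : A →ₗ[R] B) (g : B →ₗ[R] D) : Prop where
  injective : Function.Injective f
  exact : Function.Exact f g
  surjective : Function.Surjective g

/-- `B` is an extension of `D` by `A`. -/
def IsExtension (A B D : ModuleCat.{u} R) : Prop :=
  ∃ (f : A →ₗ[R] B) (g : B →ₗ[R] D), IsShortExact f g

/-- Vanishing of `Ext^i(A, B)`. -/
def ExtVanish (A B : ModuleCat.{u} R) (i : ℕ) : Prop :=
  Subsingleton (Abelian.Ext A B i)

namespace IsShortExact

variable {A B D : ModuleCat.{u} R} {f : A →ₗ[R] B} {g : B →ₗ[R] D}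

theorem comp_eq_zero (h : IsShortExact f g) : g ∘ₗ f = 0 := h.exact.linearMap_comp_eq_zero

theorem isExtension (h : IsShortExact f g) : IsExtension A B D := ⟨f, g, h⟩

/-- The corresponding short complex in the category of modules. -/
abbrev shortComplex (h : IsShortExact f g) : ShortComplex (ModuleCat.{u} R) :=
  ShortComplex.mk (X₁ := A) (X₂ := B) (X₃ := D) (ModuleCat.ofHom f) (ModuleCat.ofHom g)
    (ModuleCat.hom_ext h.comp_eq_zero)

theorem shortExact (h : IsShortExact f g) : h.shortComplex.ShortExact :=
  ModuleCat.shortComplex_shortExact _ h.exact h.injective h.surjective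

variable {X : ModuleCat.{u} R} {i : ℕ}

theorem extVanish_right (h : IsShortExact f g) (hA : ExtVanish A X i)
    (hB : ExtVanish B X (i + 1)) : ExtVanish D X (i + 1) := by
  refine ⟨fun x y => sub_eq_zero.1 ?_⟩
  obtain ⟨z, hz⟩ := Abelian.Ext.contravariant_sequence_exact₃ h.shortExact X (x - y)
    (hB.elim _ _) (add_comm 1 i)
  obtain rfl : z = 0 := hA.elim _ _
  rw [← hz, Abelian.Ext.comp_zero]

theorem extVanish_left (h : IsShortExact f g) (hB : ExtVanish B X i)
    (hD : ExtVanish D X (i + 1)) : ExtVanish A X i := by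
  refine ⟨fun x y => sub_eq_zero.1 ?_⟩
  obtain ⟨z, hz⟩ := Abelian.Ext.contravariant_sequence_exact₁ h.shortExact X (x - y)
    (add_comm 1 i) (hD.elim _ _)
  obtain rfl : z = 0 := hB.elim _ _
  rw [← hz, Abelian.Ext.comp_zero]

theorem exists_extension (h : IsShortExact f g) (hD : ExtVanish D X 1) (a : A →ₗ[R] X) :
    ∃ b : B →ₗ[R] X, b ∘ₗ f = a := by
  obtain ⟨z, hz⟩ := Abelian.Ext.contravariant_sequence_exact₁ h.shortExact X
    (Abelian.Ext.mk₀ (ModuleCat.ofHom a)) (add_zero 1) (hD.elim _ _)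
  obtain ⟨b, rfl⟩ := (Abelian.Ext.mk₀_bijective _ _).2 z
  rw [Abelian.Ext.mk₀_comp_mk₀] at hz
  have := congrArg ModuleCat.Hom.hom ((Abelian.Ext.mk₀_bijective _ _).1 hz)
  exact ⟨b.hom, this⟩

theorem extVanish_one_right (h : IsShortExact f g) (hB : ExtVanish B X 1)
    (hA : ∀ a : A →ₗ[R] X, ∃ b : B →ₗ[R] X, b ∘ₗ f = a) : ExtVanish D X 1 := by
  refine ⟨fun x y => sub_eq_zero.1 ?_⟩
  obtain ⟨z, hz⟩ := Abelian.Ext.contravariant_sequence_exact₃ h.shortExact X (x - y)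
    (hB.elim _ _) (add_zero 1)
  obtain ⟨a, rfl⟩ := (Abelian.Ext.mk₀_bijective _ _).2 z
  obtain ⟨b, hb⟩ := hA a.hom
  obtain rfl : a = ModuleCat.ofHom f ≫ ModuleCat.ofHom b := ModuleCat.hom_ext hb.symm
  rw [← hz, ← Abelian.Ext.mk₀_comp_mk₀,
    h.shortExact.extClass_comp_assoc]

theorem extVanish_covariant_middle (h : IsShortExact f g) (hA : ExtVanish X A i)
    (hD : ExtVanish X D i) : ExtVanish X B i := by
  refine ⟨fun x y => sub_eq_zero.1 ?_⟩
  obtain ⟨z, hz⟩ := Abelian.Ext.covariant_sequence_exact₂ X h.shortExact (x - y)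
    (hD.elim _ _)
  obtain rfl : z = 0 := hA.elim _ _
  rw [← hz, Abelian.Ext.zero_comp]

theorem extVanish_covariant_left (h : IsShortExact f g) (hD : ExtVanish X D i)
    (hB : ExtVanish X B (i + 1)) : ExtVanish X A (i + 1) := by
  refine ⟨fun x y => sub_eq_zero.1 ?_⟩
  obtain ⟨z, hz⟩ := Abelian.Ext.covariant_sequence_exact₁ X h.shortExact (x - y)
    (hB.elim _ _) rfl
  obtain rfl : z = 0 := hD.elim _ _
  rw [← hz, Abelian.Ext.zero_comp]

theorem extVanish_covariant_right (h : IsShortExact f g) (hB : ExtVanish X B i)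
    (hA : ExtVanish X A (i + 1)) : ExtVanish X D i := by
  refine ⟨fun x y => sub_eq_zero.1 ?_⟩
  obtain ⟨z, hz⟩ := Abelian.Ext.covariant_sequence_exact₃ X h.shortExact (x - y)
    rfl (hA.elim _ _)
  obtain rfl : z = 0 := hB.elim _ _
  rw [← hz, Abelian.Ext.zero_comp]

theorem exists_lift (h : IsShortExact f g) (hA : ExtVanish X A 1) (a : X →ₗ[R] D) :
    ∃ b : X →ₗ[R] B, g ∘ₗ b = a := by
  obtain ⟨z, hz⟩ := Abelian.Ext.covariant_sequence_exact₃ X h.shortExact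
    (Abelian.Ext.mk₀ (ModuleCat.ofHom a)) (zero_add 1) (hA.elim _ _)
  obtain ⟨b, rfl⟩ := (Abelian.Ext.mk₀_bijective _ _).2 z
  rw [Abelian.Ext.mk₀_comp_mk₀] at hz
  have := congrArg ModuleCat.Hom.hom ((Abelian.Ext.mk₀_bijective _ _).1 hz)
  exact ⟨b.hom, this⟩

end IsShortExact

namespace ExtVanish

variable {A B X Y : ModuleCat.{u} R} {i : ℕ}

theorem of_retract_left (s : A →ₗ[R] B) (r : B →ₗ[R] A) (h : r ∘ₗ s = LinearMap.id)
    (hB : ExtVanish B X i) : ExtVanish A X i := by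
  refine ⟨fun x y => ?_⟩
  have key (x : Abelian.Ext A X i) : (Abelian.Ext.mk₀ (ModuleCat.ofHom s)).comp
      ((Abelian.Ext.mk₀ (ModuleCat.ofHom r)).comp x (zero_add i)) (zero_add i) = x := by
    rw [Abelian.Ext.mk₀_comp_mk₀_assoc, ← ModuleCat.ofHom_comp, h]
    exact Abelian.Ext.mk₀_id_comp x
  rw [← key x, ← key y]
  congr 1
  exact hB.elim _ _

theorem of_retract_right (s : X →ₗ[R] Y) (r : Y →ₗ[R] X) (h : r ∘ₗ s = LinearMap.id)
    (hB : ExtVanish A Y i) : ExtVanish A X i := by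
  refine ⟨fun x y => ?_⟩
  have key (x : Abelian.Ext A X i) : (x.comp (Abelian.Ext.mk₀ (ModuleCat.ofHom s))
      (add_zero i)).comp (Abelian.Ext.mk₀ (ModuleCat.ofHom r)) (add_zero i) = x := by
    rw [Abelian.Ext.comp_assoc_of_second_deg_zero, Abelian.Ext.mk₀_comp_mk₀,
      ← ModuleCat.ofHom_comp, h]
    exact Abelian.Ext.comp_mk₀_id x
  rw [← key x, ← key y]
  congr 1
  exact hB.elim _ _

theorem congr_left (e : A ≃ₗ[R] B) (hB : ExtVanish B X i) : ExtVanish A X i :=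
  of_retract_left e.toLinearMap e.symm.toLinearMap (by ext; simp) hB

theorem congr_right (e : X ≃ₗ[R] Y) (hB : ExtVanish A Y i) : ExtVanish A X i :=
  of_retract_right e.toLinearMap e.symm.toLinearMap (by ext; simp) hB

theorem of_projective [Module.Projective R A] : ExtVanish A X (i + 1) :=
  haveI := ModuleCat.projective_of_module_projective (R := R) A
  Abelian.Ext.subsingleton_of_projective A X i

theorem of_injective [Module.Injective R X] : ExtVanish A X (i + 1) :=
  haveI := Module.injective_object_of_injective_module R X
  Abelian.Ext.subsingleton_of_injective A X i

end ExtVanish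

end

section
variable {R : Type u} [CommRing R]

theorem isShortExact_mkQ {A B : Type*} [AddCommGroup A] [AddCommGroup B] [Module R A] [Module R B]
    (f : A →ₗ[R] B) (hf : Function.Injective f) : IsShortExact f (LinearMap.range f).mkQ :=
  ⟨hf, LinearMap.exact_map_mkQ_range f, Submodule.mkQ_surjective _⟩

theorem isShortExact_ker_subtype {B D : Type*} [AddCommGroup B] [AddCommGroup D] [Module R B]
    [Module R D] (g : B →ₗ[R] D) (hg : Function.Surjective g) :
    IsShortExact (LinearMap.ker g).subtype g :=
  ⟨Subtype.val_injective, LinearMap.exact_subtype_ker_map g, hg⟩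

namespace IsShortExact

section
variable {A B D X : Type*} [AddCommGroup A] [AddCommGroup B] [AddCommGroup D] [AddCommGroup X]
  [Module R A] [Module R B] [Module R D] [Module R X] {f : A →ₗ[R] B} {g : B →ₗ[R] D}

theorem apply_apply (h : IsShortExact f g) (a : A) : g (f a) = 0 := h.exact.apply_apply_eq_zero a

theorem exists_of_apply_eq_zero (h : IsShortExact f g) {b : B} (hb : g b = 0) : ∃ a, f a = b :=
  (h.exact b).1 hb

theorem exists_desc (h : IsShortExact f g) (k : B →ₗ[R] X) (hk : ∀ a, k (f a) = 0) :
    ∃ l : D →ₗ[R] X, ∀ b, l (g b) = k b := by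
  refine ⟨((LinearMap.ker g).liftQ k ?_) ∘ₗ
    (g.quotKerEquivOfSurjective h.surjective).symm.toLinearMap, fun b => ?_⟩
  · intro b hb
    obtain ⟨a, rfl⟩ := h.exists_of_apply_eq_zero hb
    exact hk a
  · have : (g.quotKerEquivOfSurjective h.surjective).symm (g b) = Submodule.Quotient.mk b := by
      rw [LinearEquiv.symm_apply_eq]; rfl
    simp [this]

theorem exists_codesc (h : IsShortExact f g) (k : X →ₗ[R] B) (hk : ∀ x, g (k x) = 0) :
    ∃ l : X →ₗ[R] A, ∀ x, f (l x) = k x := by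
  refine ⟨(LinearEquiv.ofInjective f h.injective).symm.toLinearMap ∘ₗ
    k.codRestrict (LinearMap.range f) fun x => h.exists_of_apply_eq_zero (hk x), fun x => ?_⟩
  have := (LinearEquiv.ofInjective f h.injective).apply_symm_apply
    (k.codRestrict (LinearMap.range f) (fun x => h.exists_of_apply_eq_zero (hk x)) x)
  exact congrArg Subtype.val this

end

end IsShortExact

/-- A short exact sequence with a retraction splits. -/
theorem IsExtension.nonempty_linearEquiv_prod {A B D : ModuleCat.{u} R} (h : IsExtension A B D)
    (hD : ExtVanish D A 1) : Nonempty (B ≃ₗ[R] A × D) := by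
  obtain ⟨f, g, h⟩ := h
  obtain ⟨r, hr⟩ := h.exists_extension hD LinearMap.id
  have hr (a : A) : r (f a) = a := LinearMap.congr_fun hr a
  refine ⟨LinearEquiv.ofBijective (r.prod g) ⟨?_, ?_⟩⟩
  · rw [injective_iff_map_eq_zero]
    intro b hb
    obtain ⟨h1, h2⟩ := Prod.mk.inj hb
    obtain ⟨a, rfl⟩ := h.exists_of_apply_eq_zero h2
    rw [← hr a, h1, map_zero]
  · rintro ⟨a, d⟩
    obtain ⟨b, rfl⟩ := h.surjective d
    exact ⟨b + f (a - r b), by simp [hr, h.apply_apply]⟩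

namespace IsExtension

variable {A B D X W : ModuleCat.{u} R}

theorem congr {A' B' D' : ModuleCat.{u} R} (h : IsExtension A B D) (eA : A' ≃ₗ[R] A)
    (eB : B ≃ₗ[R] B') (eD : D ≃ₗ[R] D') : IsExtension A' B' D' := by
  obtain ⟨f, g, h⟩ := h
  refine ⟨eB.toLinearMap ∘ₗ f ∘ₗ eA.toLinearMap, eD.toLinearMap ∘ₗ g ∘ₗ eB.symm.toLinearMap,
    eB.injective.comp (h.injective.comp eA.injective), fun b => ⟨fun hb => ?_, ?_⟩,
    eD.surjective.comp (h.surjective.comp eB.symm.surjective)⟩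
  · obtain ⟨a, ha⟩ := h.exists_of_apply_eq_zero (b := eB.symm b) (by simpa using hb)
    exact ⟨eA.symm a, by simp [ha]⟩
  · rintro ⟨a, rfl⟩
    simp [h.apply_apply]

theorem prod {A' B' D' : ModuleCat.{u} R} (h : IsExtension A B D) (h' : IsExtension A' B' D') :
    IsExtension (.of R (A × A')) (.of R (B × B')) (.of R (D × D')) := by
  obtain ⟨f, g, h⟩ := h
  obtain ⟨f', g', h'⟩ := h'
  refine ⟨f.prodMap f', g.prodMap g', h.injective.prodMap h'.injective, ?_,
    h.surjective.prodMap h'.surjective⟩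
  rintro ⟨b, b'⟩
  constructor
  · intro hb
    obtain ⟨h1, h2⟩ := Prod.mk.inj hb
    obtain ⟨a, rfl⟩ := h.exists_of_apply_eq_zero h1
    obtain ⟨a', rfl⟩ := h'.exists_of_apply_eq_zero h2
    exact ⟨(a, a'), rfl⟩
  · rintro ⟨⟨a, a'⟩, haa⟩
    obtain ⟨rfl, rfl⟩ := Prod.mk.inj haa
    exact Prod.ext (h.apply_apply a) (h'.apply_apply a')

theorem prod_inl : IsExtension A (.of R (A × D)) D :=
  ⟨LinearMap.inl R A D, LinearMap.snd R A D, LinearMap.inl_injective, Function.Exact.inl_snd,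
    LinearMap.snd_surjective⟩

theorem of_subsingleton_left [Subsingleton A] : IsExtension A B B :=
  ⟨0, LinearMap.id, Function.injective_of_subsingleton _, fun b =>
    ⟨fun hb => ⟨0, by simpa using hb.symm⟩, by rintro ⟨a, rfl⟩; rfl⟩, Function.surjective_id⟩

theorem of_subsingleton_right [Subsingleton D] : IsExtension B B D :=
  ⟨LinearMap.id, 0, Function.injective_id, fun b => ⟨fun _ => ⟨b, rfl⟩, fun _ => rfl⟩,
    fun _ => ⟨0, Subsingleton.elim _ _⟩⟩

/-- `0 → X × A → X × B → D → 0`. -/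
theorem prod_left (h : IsExtension A B D) : IsExtension (.of R (X × A)) (.of R (X × B)) D :=
  ((of_subsingleton_right (B := X) (D := .of R PUnit)).prod h).congr (.refl R _) (.refl R _)
    (LinearEquiv.uniqueProd : (PUnit.{u + 1} × D) ≃ₗ[R] D)

/-- `0 → A → B × X → D × X → 0`. -/
theorem prod_right (h : IsExtension A B D) : IsExtension A (.of R (B × X)) (.of R (D × X)) :=
  (h.prod (of_subsingleton_left (A := .of R PUnit) (B := X))).congr
    (LinearEquiv.prodUnique : (A × PUnit.{u + 1}) ≃ₗ[R] A).symm (.refl R _) (.refl R _)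

theorem exists_cokernel (h : IsExtension A B D) (h' : IsExtension B X W) :
    ∃ Q, IsExtension A X Q ∧ IsExtension D Q W := by
  obtain ⟨f, g, h⟩ := h
  obtain ⟨p, q, h'⟩ := h'
  have hpf := isShortExact_mkQ (p ∘ₗ f) (h'.injective.comp h.injective)
  obtain ⟨l, hl⟩ := h.exists_desc ((LinearMap.range (p ∘ₗ f)).mkQ ∘ₗ p) hpf.apply_apply
  obtain ⟨r, hr⟩ := hpf.exists_desc q fun a => h'.apply_apply (f a)
  refine ⟨.of R (X ⧸ LinearMap.range (p ∘ₗ f)), hpf.isExtension, l, r, ?_, ?_, ?_⟩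
  · rw [injective_iff_map_eq_zero]
    intro d hd
    obtain ⟨b, rfl⟩ := h.surjective d
    rw [hl] at hd
    obtain ⟨a, ha⟩ := hpf.exists_of_apply_eq_zero hd
    rw [← h'.injective ha, h.apply_apply]
  · intro x
    constructor
    · intro hx
      obtain ⟨x, rfl⟩ := hpf.surjective x
      rw [hr] at hx
      obtain ⟨b, rfl⟩ := h'.exists_of_apply_eq_zero hx
      exact ⟨g b, hl b⟩
    · rintro ⟨d, rfl⟩
      obtain ⟨b, rfl⟩ := h.surjective d
      rw [hl]
      exact (hr (p b)).trans (h'.apply_apply b)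
  · intro w
    obtain ⟨x, rfl⟩ := h'.surjective w
    exact ⟨_, hr x⟩

theorem exists_kernel {K L : ModuleCat.{u} R} (h : IsExtension K B A) (h' : IsExtension L X B) :
    ∃ T, IsExtension T X A ∧ IsExtension L T K := by
  obtain ⟨f, g, h⟩ := h
  obtain ⟨p, q, h'⟩ := h'
  have hgq := isShortExact_ker_subtype (g ∘ₗ q) (h.surjective.comp h'.surjective)
  obtain ⟨l, hl⟩ := h.exists_codesc (q ∘ₗ (LinearMap.ker (g ∘ₗ q)).subtype) hgq.apply_apply
  obtain ⟨r, hr⟩ := hgq.exists_codesc p fun x => by simp [h'.apply_apply]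
  refine ⟨.of R (LinearMap.ker (g ∘ₗ q)), ⟨_, _, hgq⟩, r, l, ?_, ?_, ?_⟩
  · intro x y hxy
    exact h'.injective (by rw [← hr, ← hr, hxy])
  · intro t
    constructor
    · intro ht
      have := hl t
      rw [ht, map_zero] at this
      obtain ⟨x, hx⟩ := h'.exists_of_apply_eq_zero this.symm
      exact ⟨x, Subtype.val_injective ((hr x).trans hx)⟩
    · rintro ⟨x, rfl⟩
      apply h.injective
      rw [hl, map_zero]
      exact (congrArg q (hr x)).trans (h'.apply_apply x)
  · intro k
    obtain ⟨x, hx⟩ := h'.surjective (f k)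
    refine ⟨⟨x, by simp [hx, h.apply_apply]⟩, h.injective ?_⟩
    rw [hl]
    exact hx

theorem exists_pushout {Z Q : ModuleCat.{u} R} (h : IsExtension A B D) (h' : IsExtension A Z Q) :
    ∃ H, IsExtension Z H D ∧ IsExtension B H Q := by
  obtain ⟨f, g, h⟩ := h
  obtain ⟨p, q, h'⟩ := h'
  let k : A →ₗ[R] B × Z := f.prod (-p)
  have hk : IsShortExact k (LinearMap.range k).mkQ :=
    isShortExact_mkQ k fun a a' haa => h.injective (Prod.mk.inj haa).1
  obtain ⟨l, hl⟩ := hk.exists_desc (g ∘ₗ LinearMap.fst R B Z) h.apply_apply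
  obtain ⟨m, hm⟩ := hk.exists_desc (q ∘ₗ LinearMap.snd R B Z) fun a => by
    simp [k, h'.apply_apply]
  refine ⟨.of R ((B × Z) ⧸ LinearMap.range k),
    ⟨(LinearMap.range k).mkQ ∘ₗ LinearMap.inr R B Z, l, ?_, ?_, ?_⟩,
    (LinearMap.range k).mkQ ∘ₗ LinearMap.inl R B Z, m, ?_, ?_, ?_⟩
  · rw [injective_iff_map_eq_zero]
    intro z hz
    obtain ⟨a, ha⟩ := hk.exists_of_apply_eq_zero hz
    obtain ⟨h1, rfl⟩ := Prod.mk.inj ha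
    rw [(injective_iff_map_eq_zero f).1 h.injective a h1]
    simp
  · intro x
    constructor
    · intro hx
      obtain ⟨⟨b, z⟩, rfl⟩ := hk.surjective x
      rw [hl] at hx
      obtain ⟨a, rfl⟩ := h.exists_of_apply_eq_zero hx
      refine ⟨z + p a, ?_⟩
      refine (Submodule.Quotient.eq _).2 ⟨-a, ?_⟩
      simp [k]
    · rintro ⟨z, rfl⟩
      exact (hl (0, z)).trans (map_zero g)
  · intro d
    obtain ⟨b, rfl⟩ := h.surjective d
    exact ⟨_, hl (b, 0)⟩
  · rw [injective_iff_map_eq_zero]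
    intro b hb
    obtain ⟨a, ha⟩ := hk.exists_of_apply_eq_zero hb
    obtain ⟨rfl, h2⟩ := Prod.mk.inj ha
    rw [(injective_iff_map_eq_zero p).1 h'.injective a (by simpa using h2)]
    simp
  · intro x
    constructor
    · intro hx
      obtain ⟨⟨b, z⟩, rfl⟩ := hk.surjective x
      rw [hm] at hx
      obtain ⟨a, rfl⟩ := h'.exists_of_apply_eq_zero hx
      refine ⟨b + f a, ?_⟩
      refine (Submodule.Quotient.eq _).2 ⟨a, ?_⟩
      simp [k]
    · rintro ⟨b, rfl⟩
      exact (hm (b, 0)).trans (map_zero q)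
  · intro d
    obtain ⟨z, rfl⟩ := h'.surjective d
    exact ⟨_, hm (0, z)⟩

theorem exists_pullback {K L N P : ModuleCat.{u} R} (h : IsExtension K X N)
    (h' : IsExtension L P N) : ∃ T, IsExtension K T P ∧ IsExtension L T X := by
  obtain ⟨f, g, h⟩ := h
  obtain ⟨p, q, h'⟩ := h'
  let k : X × P →ₗ[R] N := g.coprod (-q)
  have hk : IsShortExact (LinearMap.ker k).subtype k :=
    isShortExact_ker_subtype k fun n => by
      obtain ⟨x, rfl⟩ := h.surjective n
      exact ⟨(x, 0), by simp [k]⟩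
  have hT (t : LinearMap.ker k) : g t.1.1 = q t.1.2 := by
    have : g t.1.1 + (-q) t.1.2 = 0 := t.2
    rwa [LinearMap.neg_apply, ← sub_eq_add_neg, sub_eq_zero] at this
  obtain ⟨l, hl⟩ := hk.exists_codesc (LinearMap.inl R X P ∘ₗ f) fun a => by
    simp [k, h.apply_apply]
  obtain ⟨m, hm⟩ := hk.exists_codesc (LinearMap.inr R X P ∘ₗ p) fun a => by
    simp [k, h'.apply_apply]
  refine ⟨.of R (LinearMap.ker k),
    ⟨l, LinearMap.snd R X P ∘ₗ (LinearMap.ker k).subtype, ?_, ?_, ?_⟩,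
    m, LinearMap.fst R X P ∘ₗ (LinearMap.ker k).subtype, ?_, ?_, ?_⟩
  · intro a b hab
    refine h.injective (LinearMap.inl_injective (R := R) (M₂ := P) ((hl a).symm.trans ?_))
    rw [hab]
    exact hl b
  · intro t
    constructor
    · intro ht
      have h2 : t.1.2 = 0 := ht
      obtain ⟨a, ha⟩ := h.exists_of_apply_eq_zero ((hT t).trans (by rw [h2, map_zero]))
      refine ⟨a, Subtype.val_injective ((hl a).trans ?_)⟩
      exact Prod.ext ha h2.symm
    · rintro ⟨a, rfl⟩
      exact congrArg Prod.snd (hl a)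
  · intro y
    obtain ⟨x, hx⟩ := h.surjective (q y)
    exact ⟨⟨(x, y), by simp [k, hx]⟩, rfl⟩
  · intro a b hab
    refine h'.injective (LinearMap.inr_injective (R := R) (M := X) ((hm a).symm.trans ?_))
    rw [hab]
    exact hm b
  · intro t
    constructor
    · intro ht
      have h2 : t.1.1 = 0 := ht
      obtain ⟨a, ha⟩ := h'.exists_of_apply_eq_zero ((hT t).symm.trans (by rw [h2, map_zero]))
      refine ⟨a, Subtype.val_injective ((hm a).trans ?_)⟩
      exact Prod.ext h2.symm ha
    · rintro ⟨a, rfl⟩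
      exact congrArg Prod.fst (hm a)
  · intro y
    obtain ⟨x, hx⟩ := h'.surjective (g y)
    exact ⟨⟨(y, x), by simp [k, hx]⟩, rfl⟩

theorem exists_horseshoe_right {A₁ D₁ Y : ModuleCat.{u} R} (h : IsExtension A B D)
    (hA : IsExtension A X A₁) (hD : IsExtension D Y D₁) (hDX : ExtVanish D X 1) :
    ∃ Q, IsExtension B (.of R (X × Y)) Q ∧ IsExtension A₁ Q D₁ := by
  obtain ⟨H, hH, hB⟩ := h.exists_pushout hA
  obtain ⟨e⟩ := hH.nonempty_linearEquiv_prod hDX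
  exact (hB.congr (.refl R _) e (.refl R _)).exists_cokernel (hD.prod_left (X := X))

theorem exists_horseshoe_left {A' D' P P' : ModuleCat.{u} R} [Module.Projective R P']
    (h : IsExtension A B D) (hA : IsExtension A' P A) (hD : IsExtension D' P' D) :
    ∃ B', IsExtension B' (.of R (P × P')) B ∧ IsExtension A' B' D' := by
  obtain ⟨T, hT, hB⟩ := h.exists_pullback hD
  obtain ⟨e⟩ := hT.nonempty_linearEquiv_prod .of_projective
  exact (hB.congr (.refl R _) e (.refl R _)).exists_kernel (hA.prod_right (X := P'))

end IsExtension

end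

section
variable {R : Type u} [CommRing R]

section
variable {A B P N X E J : Type u} [AddCommGroup A] [AddCommGroup B] [AddCommGroup X]
  [AddCommGroup E] [AddCommGroup J] [AddCommGroup P] [AddCommGroup N] [Module R A] [Module R B]
  [Module R X] [Module R E] [Module R J] [Module R P] [Module R N]

theorem Module.Injective.of_linearEquiv (e : A ≃ₗ[R] B) (h : Module.Injective R A) :
    Module.Injective R B :=
  (Module.Baer.of_equiv e (Module.Baer.of_injective h)).injective

theorem Module.Injective.of_retract (s : A →ₗ[R] B) (r : B →ₗ[R] A) (h : ∀ a, r (s a) = a)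
    (hB : Module.Injective R B) : Module.Injective R A :=
  ⟨fun X Y _ _ _ _ f hf g => by
    obtain ⟨k, hk⟩ := Module.Injective.out f hf (s ∘ₗ g)
    exact ⟨r ∘ₗ k, fun x => by simp [hk, h]⟩⟩

/-- A map vanishing on the image of `f` factors through `g` when the target is injective. -/
theorem Function.Exact.exists_factor [Module.Injective R E] {D : Type u} [AddCommGroup D]
    [Module R D] {f : A →ₗ[R] B} {g : B →ₗ[R] D} (h : Function.Exact f g) (k : B →ₗ[R] E)
    (hk : ∀ a, k (f a) = 0) : ∃ l : D →ₗ[R] E, ∀ b, l (g b) = k b := by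
  have hg := isShortExact_ker_subtype g.rangeRestrict g.surjective_rangeRestrict
  obtain ⟨m, hm⟩ := hg.exists_desc k fun b => by
    obtain ⟨a, ha⟩ := (h b.1).1 (congrArg Subtype.val (hg.apply_apply b))
    exact (congrArg k ha.symm).trans (hk a)
  obtain ⟨l, hl⟩ := Module.Injective.out (LinearMap.range g).subtype
    (Submodule.injective_subtype _) m
  exact ⟨l, fun b => (hl (g.rangeRestrict b)).trans (hm b)⟩

theorem exists_extension_of_rTensor_injective [Module.Injective R E] (f : A →ₗ[R] B)
    (hf : Function.Injective (f.rTensor J)) (a : A →ₗ[R] J →ₗ[R] E) :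
    ∃ b : B →ₗ[R] J →ₗ[R] E, b ∘ₗ f = a := by
  obtain ⟨k, hk⟩ := Module.Injective.out (f.rTensor J) hf (TensorProduct.lift a)
  refine ⟨TensorProduct.curry k, LinearMap.ext fun x => LinearMap.ext fun j => ?_⟩
  simpa using hk (x ⊗ₜ j)

instance Module.Injective.hom_of_flat [Module.Flat R A] [Module.Injective R E] :
    Module.Injective R (A →ₗ[R] E) :=
  ⟨fun _ _ _ _ _ _ f hf g => by
    obtain ⟨b, hb⟩ := exists_extension_of_rTensor_injective f
      (Module.Flat.rTensor_preserves_injective_linearMap (M := A) f hf) g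
    exact ⟨b, LinearMap.congr_fun hb⟩⟩

instance : Module.Injective R (CharacterModule R) :=
  Module.Flat.iff_characterModule_injective.1 inferInstance

/-- Maps into the injective cogenerator are characters. -/
noncomputable def homCharacterEquiv (A : Type u) [AddCommGroup A] [Module R A] :
    (A →ₗ[R] CharacterModule R) ≃ₗ[R] CharacterModule A :=
  CharacterModule.homEquiv ≪≫ₗ CharacterModule.congr (TensorProduct.rid R A)

theorem exists_hom_character_ne_zero {a : A} (ha : a ≠ 0) :
    ∃ c : A →ₗ[R] CharacterModule R, c a ≠ 0 := by
  obtain ⟨c, hc⟩ := CharacterModule.exists_character_apply_ne_zero_of_ne_zero ha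
  refine ⟨(homCharacterEquiv A).symm c, fun h => hc ?_⟩
  have : c (TensorProduct.rid R A (a ⊗ₜ 1)) = 0 := DFunLike.congr_fun h (1 : R)
  simpa using this

theorem surjective_of_lcomp_character_injective (f : A →ₗ[R] B)
    (hf : Function.Injective (f.lcomp R (CharacterModule R))) : Function.Surjective f := by
  intro b
  by_contra hb
  have : (LinearMap.range f).mkQ b ≠ 0 := by
    simpa [Submodule.Quotient.mk_eq_zero] using hb
  obtain ⟨c, hc⟩ := exists_hom_character_ne_zero (R := R) this
  have h0 : c ∘ₗ (LinearMap.range f).mkQ = 0 := hf <| by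
    refine LinearMap.ext fun a => ?_
    have : (LinearMap.range f).mkQ (f a) = 0 :=
      (LinearMap.exact_map_mkQ_range f).apply_apply_eq_zero a
    simpa using congrArg c this
  exact hc (LinearMap.congr_fun h0 b)

theorem lcomp_surjective_of_injective [Module.Injective R E] (f : A →ₗ[R] B)
    (hf : Function.Injective f) : Function.Surjective (f.lcomp R E) := fun a => by
  obtain ⟨b, hb⟩ := Module.Injective.out f hf a
  exact ⟨b, LinearMap.ext hb⟩

theorem lcomp_injective_of_surjective (f : A →ₗ[R] B)
    (hf : Function.Surjective f) : Function.Injective (f.lcomp R E) := fun a b hab => by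
  ext x
  obtain ⟨x, rfl⟩ := hf x
  exact LinearMap.congr_fun hab x

theorem lcomp_exact [Module.Injective R E] {D : Type u} [AddCommGroup D] [Module R D]
    {f : A →ₗ[R] B} {g : B →ₗ[R] D} (h : Function.Exact f g) :
    Function.Exact (g.lcomp R E) (f.lcomp R E) := fun k => by
  constructor
  · intro hk
    obtain ⟨l, hl⟩ := h.exists_factor k (LinearMap.congr_fun hk)
    exact ⟨l, LinearMap.ext hl⟩
  · rintro ⟨l, rfl⟩
    ext a
    simp [h.apply_apply_eq_zero]

theorem IsShortExact.lcomp [Module.Injective R E] {D : Type u} [AddCommGroup D] [Module R D]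
    {f : A →ₗ[R] B} {g : B →ₗ[R] D} (h : IsShortExact f g) :
    IsShortExact (g.lcomp R E) (f.lcomp R E) :=
  ⟨lcomp_injective_of_surjective g h.surjective, lcomp_exact h.exact,
    lcomp_surjective_of_injective f h.injective⟩

variable (R P X E) in
/-- The evaluation map `P ⊗ Hom(X, E) → Hom(Hom(P, X), E)`. -/
noncomputable def tensorHomEval : P ⊗[R] (X →ₗ[R] E) →ₗ[R] (P →ₗ[R] X) →ₗ[R] E :=
  TensorProduct.lift ((LinearMap.llcomp R (P →ₗ[R] X) X E).flip ∘ₗ LinearMap.applyₗ)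

@[simp]
theorem tensorHomEval_tmul (p : P) (f : X →ₗ[R] E) (g : P →ₗ[R] X) :
    tensorHomEval R P X E (p ⊗ₜ f) g = f (g p) := rfl

theorem tensorHomEval_rTensor (f : N →ₗ[R] P) (t : N ⊗[R] (X →ₗ[R] E)) :
    tensorHomEval R P X E (f.rTensor (X →ₗ[R] E) t) =
      (f.lcomp R X).lcomp R E (tensorHomEval R N X E t) := by
  induction t with
  | zero => simp
  | add s t hs ht => simp only [map_add, hs, ht]
  | tmul n g => rfl

theorem tensorHomEval_pi_bijective (k : ℕ) :
    Function.Bijective (tensorHomEval R (Fin k → R) X E) := by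
  have key (t : (Fin k → R) ⊗[R] (X →ₗ[R] E)) :
      ∃ f : Fin k → X →ₗ[R] E, t = ∑ i, Pi.single i (1 : R) ⊗ₜ[R] f i := by
    induction t with
    | zero => exact ⟨0, by simp⟩
    | add s t hs ht =>
      obtain ⟨f, rfl⟩ := hs
      obtain ⟨g, rfl⟩ := ht
      exact ⟨f + g, by simp [TensorProduct.tmul_add, Finset.sum_add_distrib]⟩
    | tmul v g =>
      refine ⟨fun i => v i • g, ?_⟩
      conv_lhs => rw [pi_eq_sum_univ' v]
      rw [TensorProduct.sum_tmul]
      exact Finset.sum_congr rfl fun i _ => by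
        rw [TensorProduct.smul_tmul]
  constructor
  · rw [injective_iff_map_eq_zero]
    intro t ht
    obtain ⟨f, rfl⟩ := key t
    have (i : Fin k) : f i = 0 := by
      ext x
      have := LinearMap.congr_fun ht ((LinearMap.toSpanSingleton R X x) ∘ₗ LinearMap.proj i)
      simpa [Pi.single_apply, Finset.sum_ite_eq, LinearMap.sum_apply, apply_ite,
        ite_smul] using this
    simp [this]
  · intro φ
    refine ⟨∑ i, Pi.single i (1 : R) ⊗ₜ[R] (φ ∘ₗ ((LinearMap.proj i :
      (Fin k → R) →ₗ[R] R).lcomp R X) ∘ₗ (LinearMap.ringLmapEquivSelf R R X).symm.toLinearMap), ?_⟩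
    ext g
    rw [map_sum, LinearMap.sum_apply]
    simp only [tensorHomEval_tmul, LinearMap.comp_apply]
    rw [← map_sum]
    congr 1
    ext i
    simp [Pi.single_apply, ite_smul]

theorem tensorHomEval_surjective [Module.Finite R P] [Module.Injective R E] :
    Function.Surjective (tensorHomEval R P X E) := fun φ => by
  obtain ⟨k, f, hf⟩ := Module.Finite.exists_fin' R P
  obtain ⟨ψ, rfl⟩ := lcomp_surjective_of_injective (E := E) _
    (lcomp_injective_of_surjective (E := X) f hf) φ
  obtain ⟨t, rfl⟩ := (tensorHomEval_pi_bijective k).2 ψ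
  exact ⟨f.rTensor _ t, tensorHomEval_rTensor f t⟩

/-- Hom-evaluation is bijective for finitely generated modules over a noetherian ring. -/
theorem tensorHomEval_bijective [IsNoetherianRing R] [Module.Finite R P] [Module.Injective R E] :
    Function.Bijective (tensorHomEval R P X E) := by
  refine ⟨?_, tensorHomEval_surjective⟩
  rw [injective_iff_map_eq_zero]
  intro t ht
  obtain ⟨k, f, hf⟩ := Module.Finite.exists_fin' R P
  obtain ⟨t, rfl⟩ := LinearMap.rTensor_surjective (X →ₗ[R] E) hf t
  rw [tensorHomEval_rTensor] at ht
  have hs := isShortExact_ker_subtype f hf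
  have hex : Function.Exact (f.lcomp R X) ((LinearMap.ker f).subtype.lcomp R X) := fun g => by
    constructor
    · intro hg
      obtain ⟨l, hl⟩ := hs.exists_desc g (LinearMap.congr_fun hg)
      exact ⟨l, LinearMap.ext hl⟩
    · rintro ⟨l, rfl⟩
      exact LinearMap.ext fun a => (congrArg l (hs.apply_apply a)).trans (map_zero l)
  obtain ⟨s, hs'⟩ := hex.exists_factor (tensorHomEval R _ X E t) (LinearMap.congr_fun ht)
  obtain ⟨t', rfl⟩ := tensorHomEval_surjective s
  have : (LinearMap.ker f).subtype.rTensor (X →ₗ[R] E) t' = t := by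
    apply (tensorHomEval_pi_bijective k).1
    rw [tensorHomEval_rTensor]
    exact LinearMap.ext hs'
  rw [← this, ← LinearMap.comp_apply, ← LinearMap.rTensor_comp, LinearMap.comp_ker_subtype]
  simp

theorem rTensor_hom_injective [IsNoetherianRing R] [Module.Finite R N] [Module.Injective R E]
    (f : N →ₗ[R] P) (hf : Function.Surjective (f.lcomp R X)) :
    Function.Injective (f.rTensor (X →ₗ[R] E)) := by
  rw [injective_iff_map_eq_zero]
  intro t ht
  refine (injective_iff_map_eq_zero _).1 (tensorHomEval_bijective (R := R)).1 t
    (lcomp_injective_of_surjective _ hf ?_)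
  rw [← tensorHomEval_rTensor, ht, map_zero, map_zero]

instance Module.Flat.hom_of_injective [IsNoetherianRing R] [Module.Injective R X]
    [Module.Injective R E] : Module.Flat R (X →ₗ[R] E) :=
  Module.Flat.iff_rTensor_injective'.2 fun I =>
    rTensor_hom_injective _ (lcomp_surjective_of_injective _ (Submodule.injective_subtype I))

variable (R A) in
/-- The double dual with respect to the injective cogenerator. -/
abbrev DoubleDual : Type u := (A →ₗ[R] CharacterModule R) →ₗ[R] CharacterModule R

theorem Module.Flat.of_injective_dual (h : Module.Injective R (A →ₗ[R] CharacterModule R)) :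
    Module.Flat R A :=
  Module.Flat.iff_characterModule_injective.2 (h.of_linearEquiv (homCharacterEquiv A))

theorem Module.Injective.of_doubleDual [IsNoetherianRing R]
    (h : Module.Injective R (DoubleDual R A)) : Module.Injective R A := by
  have hflat := Module.Flat.of_injective_dual h
  refine (Module.Baer.iff_surjective.2 fun I => ?_).injective
  apply surjective_of_lcomp_character_injective
  rw [injective_iff_map_eq_zero]
  intro φ hφ
  obtain ⟨t, rfl⟩ := tensorHomEval_surjective (P := I) φ
  rw [← tensorHomEval_rTensor] at hφ
  have h1 := (injective_iff_map_eq_zero _).1 (tensorHomEval_bijective (R := R)).1 _ hφ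
  rw [(injective_iff_map_eq_zero _).1 (Module.Flat.iff_rTensor_injective'.1 hflat I) t h1,
    map_zero]

end

end

section
variable {R : Type u} [CommRing R]

theorem extZero.extVanish {M N : ModuleCat.{u} R} (h : extZero R M N) (i : ℕ) :
    ExtVanish M N (i + 1) := by
  let P := projectiveResolution M
  have h0 := h (i + 1) (by lia)
  have hex : (P.complex.linearYonedaObj R N).ExactAt (i + 1) := by
    rw [HomologicalComplex.exactAt_iff_isZero_homology]
    exact ((ModuleCat.isZero_iff_subsingleton).2 h0).of_iso (P.isoExt (i + 1) N).symm
  rw [HomologicalComplex.exactAt_iff' _ i (i + 1) (i + 2) (by simp) (by simp),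
    ShortComplex.moduleCat_exact_iff] at hex
  suffices ∀ x : Abelian.Ext M N (i + 1), x = 0 from ⟨fun x y => by rw [this x, this y]⟩
  intro x
  obtain ⟨f, hf, rfl⟩ := P.extMk_surjective x (i + 2) rfl
  rw [P.extMk_eq_zero_iff f (i + 2) rfl hf i rfl]
  exact hex f hf

theorem IsShortExact.extVanish_one_left {A B D X : ModuleCat.{u} R} {f : A →ₗ[R] B}
    {g : B →ₗ[R] D} (h : IsShortExact f g) (hB : ExtVanish X B 1)
    (hD : ∀ d : X →ₗ[R] D, ∃ b : X →ₗ[R] B, g ∘ₗ b = d) : ExtVanish X A 1 := by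
  refine ⟨fun x y => sub_eq_zero.1 ?_⟩
  obtain ⟨z, hz⟩ := Abelian.Ext.covariant_sequence_exact₁ X h.shortExact (x - y)
    (hB.elim _ _) (zero_add 1)
  obtain ⟨d, rfl⟩ := (Abelian.Ext.mk₀_bijective _ _).2 z
  obtain ⟨b, hb⟩ := hD d.hom
  obtain rfl : d = ModuleCat.ofHom b ≫ ModuleCat.ofHom g := ModuleCat.hom_ext hb.symm
  rw [← hz, ← Abelian.Ext.mk₀_comp_mk₀, Abelian.Ext.comp_assoc_of_second_deg_zero,
    h.shortExact.comp_extClass, Abelian.Ext.comp_zero]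

theorem exists_isExtension_projective (M : ModuleCat.{u} R) :
    ∃ K P : ModuleCat.{u} R, IsExtension K P M ∧ Module.Projective R P := by
  let f := Finsupp.linearCombination R (id : M → M)
  have hf : Function.Surjective f := Finsupp.linearCombination_id_surjective R M
  exact ⟨.of R (LinearMap.ker f), .of R (M →₀ R), ⟨_, _, isShortExact_ker_subtype f hf⟩,
    inferInstanceAs (Module.Projective R (M →₀ R))⟩

theorem exists_isExtension_injective (M : ModuleCat.{u} R) :
    ∃ I K : ModuleCat.{u} R, IsExtension M I K ∧ Module.Injective R I := by
  obtain ⟨⟨I, hI, f, hf⟩⟩ := EnoughInjectives.presentation M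
  have hf' : Function.Injective f.hom := (ModuleCat.mono_iff_injective f).1 hf
  exact ⟨I, .of R (I ⧸ LinearMap.range f.hom), ⟨_, _, isShortExact_mkQ f.hom hf'⟩,
    Module.injective_module_of_injective_object R I⟩

theorem IsExtension.hom {A B D : ModuleCat.{u} R} (h : IsExtension A B D) (E : ModuleCat.{u} R)
    [Module.Injective R E] :
    IsExtension (.of R (D →ₗ[R] E)) (.of R (B →ₗ[R] E)) (.of R (A →ₗ[R] E)) := by
  obtain ⟨f, g, h⟩ := h
  exact ⟨_, _, h.lcomp⟩

/-- Modules `Hom(J, E)` with `E` injective are cotorsion. -/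
theorem ExtVanish.flat_hom {F J E : ModuleCat.{u} R} [Module.Flat R F] [Module.Injective R E]
    (i : ℕ) : ExtVanish F (.of R (J →ₗ[R] E)) (i + 1) := by
  induction i generalizing J with
  | zero =>
    obtain ⟨K, P, ⟨f, g, h⟩, hP⟩ := exists_isExtension_projective J
    refine IsShortExact.extVanish_one_left (A := .of R (J →ₗ[R] E)) (B := .of R (P →ₗ[R] E))
      (D := .of R (K →ₗ[R] E)) h.lcomp ?_ fun d => ?_
    · have : Module.Injective R (ModuleCat.of R (P →ₗ[R] E)) :=
        inferInstanceAs (Module.Injective R (P →ₗ[R] E))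
      exact .of_injective
    · obtain ⟨k, hk⟩ := Module.Injective.out (f.lTensor F)
        (Module.Flat.lTensor_preserves_injective_linearMap (M := F) f h.injective)
        (TensorProduct.lift d)
      refine ⟨TensorProduct.curry k, LinearMap.ext fun x => LinearMap.ext fun j => ?_⟩
      simpa using hk (x ⊗ₜ j)
  | succ i ih =>
    obtain ⟨K, P, h, hP⟩ := exists_isExtension_projective J
    obtain ⟨f, g, h⟩ := h.hom E
    have : Module.Injective R (ModuleCat.of R (P →ₗ[R] E)) :=
      inferInstanceAs (Module.Injective R (P →ₗ[R] E))
    exact h.extVanish_covariant_left ih .of_injective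

variable (R) in
/-- Injective dimension at most `n`, by iterated embeddings into injective modules. -/
def InjDimLE : ℕ → ModuleCat.{u} R → Prop
  | 0, M => Module.Injective R M
  | n + 1, M => ∃ I K : ModuleCat.{u} R, IsExtension M I K ∧ Module.Injective R I ∧ InjDimLE n K

/-- Resolution dimension at most `n` with respect to a class of modules. -/
def ResDimLE (𝒳 : ModuleCat.{u} R → Prop) : ℕ → ModuleCat.{u} R → Prop
  | 0, M => 𝒳 M
  | n + 1, M => ∃ K X : ModuleCat.{u} R, IsExtension K X M ∧ 𝒳 X ∧ ResDimLE 𝒳 n K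

theorem InjDimLE.hasCoresOfLength {n : ℕ} {M : ModuleCat.{u} R} (h : InjDimLE R n M) :
    HasCoresOfLength R (fun I => Module.Injective R I) n M := by
  induction n generalizing M with
  | zero =>
    refine ⟨fun | 0 => M | _ + 1 => .of R PUnit, fun | 0 => 0 | _ + 1 => 0, LinearMap.id,
      Function.injective_id, ?_, ?_, ?_, ?_⟩
    · exact fun x => ⟨fun _ => ⟨x, rfl⟩, fun _ => rfl⟩
    · intro i x
      exact ⟨fun _ => ⟨0, Subsingleton.elim (α := PUnit) _ _⟩,
        fun _ => Subsingleton.elim (α := PUnit) _ _⟩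
    · intro i hi
      obtain rfl : i = 0 := by lia
      exact h
    · intro i hi
      obtain ⟨i, rfl⟩ : ∃ j, i = j + 1 := ⟨i - 1, by lia⟩
      exact inferInstanceAs (Subsingleton PUnit)
  | succ n ih =>
    obtain ⟨I, K, ⟨f, g, hfg⟩, hI, hK⟩ := h
    obtain ⟨P, d, η, hη, h0, hd, hP, hP'⟩ := ih hK
    refine ⟨fun | 0 => I | i + 1 => P i, fun | 0 => η ∘ₗ g | i + 1 => d i, f,
      hfg.injective, ?_, ?_, ?_, ?_⟩
    · intro x
      exact (map_eq_zero_iff η hη).trans (hfg.exact x)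
    · rintro (_ | i) x
      · refine (h0 x).trans ⟨?_, ?_⟩
        · rintro ⟨y, rfl⟩
          obtain ⟨z, rfl⟩ := hfg.surjective y
          exact ⟨z, rfl⟩
        · rintro ⟨z, rfl⟩
          exact ⟨g z, rfl⟩
      · exact hd i x
    · rintro (_ | i) hi
      exacts [hI, hP i (by lia)]
    · rintro (_ | i) hi
      exacts [by lia, hP' i (by lia)]

theorem HasCoresOfLength.injDimLE {n : ℕ} {M : ModuleCat.{u} R}
    (h : HasCoresOfLength R (fun I => Module.Injective R I) n M) : InjDimLE R n M := by
  induction n generalizing M with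
  | zero =>
    obtain ⟨P, d, η, hη, h0, hd, hP, hP'⟩ := h
    have := hP' 1 one_pos
    refine (hP 0 le_rfl).of_linearEquiv (LinearEquiv.ofBijective η ⟨hη, fun x => ?_⟩).symm
    exact (h0 x).1 (Subsingleton.elim _ _)
  | succ n ih =>
    obtain ⟨P, d, η, hη, h0, hd, hP, hP'⟩ := h
    refine ⟨P 0, .of R (LinearMap.range (d 0)), ⟨η, (d 0).rangeRestrict, hη, ?_,
      (d 0).surjective_rangeRestrict⟩, hP 0 (by lia), ih ⟨fun i => P (i + 1), fun i => d (i + 1),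
      (LinearMap.range (d 0)).subtype, Subtype.val_injective, ?_, fun i => hd (i + 1),
      fun i hi => hP (i + 1) (by lia), fun i hi => hP' (i + 1) (by lia)⟩⟩
    · intro x
      exact Subtype.ext_iff.trans (h0 x)
    · intro x
      refine (hd 0 x).trans ⟨fun hx => ⟨⟨x, hx⟩, rfl⟩, ?_⟩
      rintro ⟨y, rfl⟩
      exact y.2

theorem ResDimLE.hasResOfLength {𝒳 : ModuleCat.{u} R → Prop} {n : ℕ} {M : ModuleCat.{u} R}
    (h : ResDimLE 𝒳 n M) : HasResOfLength R 𝒳 n M := by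
  induction n generalizing M with
  | zero =>
    refine ⟨fun | 0 => M | _ + 1 => .of R PUnit, fun | 0 => 0 | _ + 1 => 0, LinearMap.id,
      Function.surjective_id, ?_, ?_, ?_, ?_⟩
    · exact fun x => ⟨fun hx => ⟨0, hx.symm⟩, by rintro ⟨y, rfl⟩; rfl⟩
    · rintro (_ | i) x
      all_goals exact ⟨fun _ => ⟨0, Subsingleton.elim (α := PUnit) _ _⟩, fun _ => rfl⟩
    · intro i hi
      obtain rfl : i = 0 := by lia
      exact h
    · intro i hi
      obtain ⟨i, rfl⟩ : ∃ j, i = j + 1 := ⟨i - 1, by lia⟩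
      exact inferInstanceAs (Subsingleton PUnit)
  | succ n ih =>
    obtain ⟨K, X, ⟨f, g, hfg⟩, hX, hK⟩ := h
    obtain ⟨P, d, ε, hε, h0, hd, hP, hP'⟩ := ih hK
    refine ⟨fun | 0 => X | i + 1 => P i, fun | 0 => f ∘ₗ ε | i + 1 => d i, g,
      hfg.surjective, ?_, ?_, ?_, ?_⟩
    · intro x
      refine (hfg.exact x).trans ⟨?_, ?_⟩
      · rintro ⟨y, rfl⟩
        obtain ⟨z, rfl⟩ := hε y
        exact ⟨z, rfl⟩
      · rintro ⟨z, rfl⟩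
        exact ⟨ε z, rfl⟩
    · rintro (_ | i) x
      · exact (map_eq_zero_iff f hfg.injective).trans (h0 x)
      · exact hd i x
    · rintro (_ | i) hi
      exacts [hX, hP i (by lia)]
    · rintro (_ | i) hi
      exacts [by lia, hP' i (by lia)]

theorem HasResOfLength.resDimLE {𝒳 : ModuleCat.{u} R → Prop}
    (h𝒳 : ∀ A B : ModuleCat.{u} R, (A ≃ₗ[R] B) → 𝒳 A → 𝒳 B) {n : ℕ} {M : ModuleCat.{u} R}
    (h : HasResOfLength R 𝒳 n M) : ResDimLE 𝒳 n M := by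
  induction n generalizing M with
  | zero =>
    obtain ⟨P, d, ε, hε, h0, hd, hP, hP'⟩ := h
    have := hP' 1 one_pos
    refine h𝒳 _ _ (LinearEquiv.ofBijective ε ⟨?_, hε⟩) (hP 0 le_rfl)
    rw [injective_iff_map_eq_zero]
    intro x hx
    obtain ⟨y, rfl⟩ := (h0 x).1 hx
    rw [Subsingleton.elim y 0, map_zero]
  | succ n ih =>
    obtain ⟨P, d, ε, hε, h0, hd, hP, hP'⟩ := h
    refine ⟨.of R (LinearMap.ker ε), P 0, ⟨_, _, isShortExact_ker_subtype ε hε⟩,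
      hP 0 (by lia), ih ⟨fun i => P (i + 1), fun i => d (i + 1),
      (d 0).codRestrict (LinearMap.ker ε) h0.apply_apply_eq_zero, ?_, ?_, fun i => hd (i + 1),
      fun i hi => hP (i + 1) (by lia), fun i hi => hP' (i + 1) (by lia)⟩⟩
    · rintro ⟨x, hx⟩
      obtain ⟨y, rfl⟩ := (h0 x).1 hx
      exact ⟨y, rfl⟩
    · intro x
      exact Subtype.ext_iff.trans (hd 0 x)

end

section
variable {R : Type u} [CommRing R]

/-- `G` has an infinite coresolution by modules in `𝒱`. -/
def HasCoresolution (𝒱 : ModuleCat.{u} R → Prop) (G : ModuleCat.{u} R) : Prop :=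
  ∃ 𝒦 : ModuleCat.{u} R → Prop, 𝒦 G ∧
    ∀ H, 𝒦 H → ∃ X Q, 𝒱 X ∧ IsExtension H X Q ∧ 𝒦 Q

/-- A class of modules, closed under finite products, of injective dimension at most `n`,
with no higher extensions between its members. -/
structure IsSelfOrthogonal (𝒱 : ModuleCat.{u} R → Prop) (n : ℕ) : Prop where
  punit : 𝒱 (.of R PUnit)
  prod {X Y : ModuleCat.{u} R} : 𝒱 X → 𝒱 Y → 𝒱 (.of R (X × Y))
  extVanish {X Y : ModuleCat.{u} R} (i : ℕ) : 𝒱 X → 𝒱 Y → ExtVanish X Y (i + 1)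
  injDim {X Y : ModuleCat.{u} R} (i : ℕ) : 𝒱 Y → n < i → ExtVanish X Y i

namespace HasCoresolution

variable {𝒱 : ModuleCat.{u} R → Prop} {n : ℕ} {A B D G : ModuleCat.{u} R}

theorem exists_isExtension (h : HasCoresolution 𝒱 G) :
    ∃ X Q, 𝒱 X ∧ IsExtension G X Q ∧ HasCoresolution 𝒱 Q := by
  obtain ⟨𝒦, hG, h𝒦⟩ := h
  obtain ⟨X, Q, hX, hGX, hQ⟩ := h𝒦 G hG
  exact ⟨X, Q, hX, hGX, 𝒦, hQ, h𝒦⟩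

theorem of_isExtension (h : IsExtension A B D) (hB : 𝒱 B) (hD : HasCoresolution 𝒱 D) :
    HasCoresolution 𝒱 A := by
  refine ⟨fun H => H = A ∨ HasCoresolution 𝒱 H, .inl rfl, ?_⟩
  rintro H (rfl | hH)
  · exact ⟨B, D, hB, h, .inr hD⟩
  · obtain ⟨X, Q, hX, hHX, hQ⟩ := hH.exists_isExtension
    exact ⟨X, Q, hX, hHX, .inr hQ⟩

theorem of_mem (h𝒱 : IsSelfOrthogonal 𝒱 n) (hA : 𝒱 A) : HasCoresolution 𝒱 A :=
  ⟨𝒱, hA, fun H hH => ⟨H, .of R PUnit, hH, .of_subsingleton_right, h𝒱.punit⟩⟩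

theorem extVanish (h𝒱 : IsSelfOrthogonal 𝒱 n) (hG : HasCoresolution 𝒱 G) {V : ModuleCat.{u} R}
    (hV : 𝒱 V) (i : ℕ) : ExtVanish G V (i + 1) := by
  suffices ∀ k i (G : ModuleCat.{u} R), HasCoresolution 𝒱 G → n < i + 1 + k →
    ExtVanish G V (i + 1) from this n i G hG (by lia)
  intro k
  induction k with
  | zero => exact fun i G _ hi => h𝒱.injDim _ hV hi
  | succ k ih =>
    intro i G hG hi
    obtain ⟨X, Q, hX, ⟨f, g, h⟩, hQ⟩ := hG.exists_isExtension
    exact h.extVanish_left (h𝒱.extVanish i hX hV) (ih (i + 1) Q hQ (by lia))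

theorem middle (h𝒱 : IsSelfOrthogonal 𝒱 n) (h : IsExtension A B D) (hA : HasCoresolution 𝒱 A)
    (hD : HasCoresolution 𝒱 D) : HasCoresolution 𝒱 B := by
  refine ⟨fun H => ∃ A D, IsExtension A H D ∧ HasCoresolution 𝒱 A ∧ HasCoresolution 𝒱 D,
    ⟨A, D, h, hA, hD⟩, ?_⟩
  rintro H ⟨A, D, h, hA, hD⟩
  obtain ⟨X, A₁, hX, hAX, hA₁⟩ := hA.exists_isExtension
  obtain ⟨Y, D₁, hY, hDY, hD₁⟩ := hD.exists_isExtension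
  obtain ⟨Q, hHQ, hQ⟩ := h.exists_horseshoe_right hAX hDY (hD.extVanish h𝒱 hX 0)
  exact ⟨_, Q, h𝒱.prod hX hY, hHQ, A₁, D₁, hQ, hA₁, hD₁⟩

theorem congr (h𝒱 : IsSelfOrthogonal 𝒱 n) (e : A ≃ₗ[R] B) (hA : HasCoresolution 𝒱 A) :
    HasCoresolution 𝒱 B :=
  middle h𝒱 (IsExtension.of_subsingleton_left.congr (.refl R _) e (.refl R A))
    (of_mem h𝒱 h𝒱.punit) hA

theorem left (h𝒱 : IsSelfOrthogonal 𝒱 n) (h : IsExtension A B D) (hB : HasCoresolution 𝒱 B)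
    (hD : HasCoresolution 𝒱 D) : HasCoresolution 𝒱 A := by
  obtain ⟨X, W, hX, hBX, hW⟩ := hB.exists_isExtension
  obtain ⟨Q, hAX, hDQ⟩ := h.exists_cokernel hBX
  exact of_isExtension hAX hX (middle h𝒱 hDQ hD hW)

/-- Modules coresolved by modules with `𝒱`-coresolutions have `𝒱`-coresolutions. -/
theorem of_hasCoresolution (h𝒱 : IsSelfOrthogonal 𝒱 n)
    (hG : HasCoresolution (HasCoresolution 𝒱) G) : HasCoresolution 𝒱 G := by
  obtain ⟨𝒦, hG, h𝒦⟩ := hG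
  refine ⟨fun H => ∃ G W, IsExtension G H W ∧ 𝒦 G ∧ HasCoresolution 𝒱 W,
    ⟨G, .of R PUnit, .of_subsingleton_right, hG, of_mem h𝒱 h𝒱.punit⟩, ?_⟩
  rintro H ⟨G, W, hH, hG, hW⟩
  obtain ⟨Z, G₁, hZ, hGZ, hG₁⟩ := h𝒦 G hG
  obtain ⟨H', hZH', hHH'⟩ := hH.exists_pushout hGZ
  obtain ⟨X, Q, hX, hX', hQ⟩ := (middle h𝒱 hZH' hZ hW).exists_isExtension
  obtain ⟨Q', hHX, hQ'⟩ := hHH'.exists_cokernel hX'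
  exact ⟨X, Q', hX, hHX, G₁, Q, hQ', hG₁, hQ⟩

end HasCoresolution

/-- `G` is an `n`-th syzygy of `M`. -/
def IsSyzygy : ℕ → ModuleCat.{u} R → ModuleCat.{u} R → Prop
  | 0, G, M => G = M
  | n + 1, G, M => ∃ K P : ModuleCat.{u} R,
      IsExtension K P M ∧ Module.Projective R P ∧ IsSyzygy n G K

theorem exists_isSyzygy (n : ℕ) (M : ModuleCat.{u} R) : ∃ G, IsSyzygy n G M := by
  induction n generalizing M with
  | zero => exact ⟨M, rfl⟩
  | succ n ih =>
    obtain ⟨K, P, h, hP⟩ := exists_isExtension_projective M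
    obtain ⟨G, hG⟩ := ih K
    exact ⟨G, K, P, h, hP, hG⟩

theorem IsExtension.exists_isSyzygy {n : ℕ} {A B D GA GD : ModuleCat.{u} R}
    (h : IsExtension A B D) (hA : IsSyzygy n GA A) (hD : IsSyzygy n GD D) :
    ∃ GB, IsSyzygy n GB B ∧ IsExtension GA GB GD := by
  induction n generalizing A B D with
  | zero =>
    obtain rfl : GA = A := hA
    obtain rfl : GD = D := hD
    exact ⟨B, rfl, h⟩
  | succ n ih =>
    obtain ⟨A', P, hA', hP, hGA⟩ := hA
    obtain ⟨D', P', hD', hP', hGD⟩ := hD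
    obtain ⟨B', hB', hAB⟩ := h.exists_horseshoe_left hA' hD'
    obtain ⟨GB, hGB, hG⟩ := ih hAB hGA hGD
    exact ⟨GB, ⟨B', _, hB', inferInstanceAs (Module.Projective R (P × P')), hGB⟩, hG⟩

theorem IsSyzygy.resDimLE {𝒳 : ModuleCat.{u} R → Prop}
    (h𝒳 : ∀ P : ModuleCat.{u} R, Module.Projective R P → 𝒳 P) {n : ℕ} {G M : ModuleCat.{u} R}
    (h : IsSyzygy n G M) (hG : 𝒳 G) : ResDimLE 𝒳 n M := by
  induction n generalizing M with
  | zero =>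
    obtain rfl : G = M := h
    exact hG
  | succ n ih =>
    obtain ⟨K, P, h, hP, hGK⟩ := h
    exact ⟨K, P, h, h𝒳 P hP, ih hGK⟩

section
variable {𝒱 : ModuleCat.{u} R → Prop} {n : ℕ}

theorem ResDimLE.of_projective_presentation (h𝒱 : IsSelfOrthogonal 𝒱 n) {m : ℕ}
    {L P N : ModuleCat.{u} R}
    (hN : ResDimLE (HasCoresolution 𝒱) (m + 1) N) (h : IsExtension L P N)
    (hP : HasCoresolution 𝒱 P) [Module.Projective R P] : ResDimLE (HasCoresolution 𝒱) m L := by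
  obtain ⟨K, Y, hK, hY, hKdim⟩ := hN
  obtain ⟨T, hT, hLT⟩ := hK.exists_pullback h
  obtain _ | m := m
  · exact .left h𝒱 hLT (.middle h𝒱 hT hKdim hP) hY
  · obtain ⟨K', Y', hK', hY', hK'dim⟩ := hKdim
    obtain ⟨e⟩ := hT.nonempty_linearEquiv_prod .of_projective
    obtain ⟨S, hS, hLS⟩ := hLT.exists_kernel
      ((hK'.prod_right (X := P)).congr (.refl R _) (.refl R _) e.symm)
    exact ⟨K', S, hLS, .left h𝒱 hS (.middle h𝒱 .prod_inl hY' hP) hY, hK'dim⟩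

theorem IsSyzygy.hasCoresolution (h𝒱 : IsSelfOrthogonal 𝒱 n)
    (hproj : ∀ P : ModuleCat.{u} R, Module.Projective R P → HasCoresolution 𝒱 P) {m : ℕ}
    {G N : ModuleCat.{u} R} (hG : IsSyzygy m G N) (hN : ResDimLE (HasCoresolution 𝒱) m N) :
    HasCoresolution 𝒱 G := by
  induction m generalizing N with
  | zero =>
    obtain rfl : G = N := hG
    exact hN
  | succ m ih =>
    obtain ⟨K, P, h, hP, hGK⟩ := hG
    exact ih hGK (hN.of_projective_presentation h𝒱 h (hproj P hP))

/-- If injective modules have bounded dimension, then so do all modules. -/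
theorem resDimLE_of_injective (h𝒱 : IsSelfOrthogonal 𝒱 n)
    (hproj : ∀ P : ModuleCat.{u} R, Module.Projective R P → HasCoresolution 𝒱 P) {m : ℕ}
    (hinj : ∀ E : ModuleCat.{u} R, Module.Injective R E → ResDimLE (HasCoresolution 𝒱) m E)
    (M : ModuleCat.{u} R) : ResDimLE (HasCoresolution 𝒱) m M := by
  obtain ⟨G, hG⟩ := exists_isSyzygy m M
  refine hG.resDimLE hproj (.of_hasCoresolution h𝒱 ⟨fun G => ∃ M, IsSyzygy m G M, ⟨M, hG⟩, ?_⟩)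
  rintro G ⟨M, hG⟩
  obtain ⟨I, K, h, hI⟩ := exists_isExtension_injective M
  obtain ⟨GK, hGK⟩ := exists_isSyzygy m K
  obtain ⟨GI, hGI, hext⟩ := h.exists_isSyzygy hG hGK
  exact ⟨GI, GK, hGI.hasCoresolution h𝒱 hproj (hinj I hI), hext, K, hGK⟩

end

end

section
variable {R : Type u} [CommRing R]

section
variable {A B D X : Type u} [AddCommGroup A] [AddCommGroup B] [AddCommGroup D] [AddCommGroup X]
  [Module R A] [Module R B] [Module R D] [Module R X] {f : A →ₗ[R] B} {g : B →ₗ[R] D}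

theorem IsShortExact.lcomp_of_exists_extension (h : IsShortExact f g)
    (hX : ∀ a : A →ₗ[R] X, ∃ b : B →ₗ[R] X, b ∘ₗ f = a) :
    IsShortExact (g.lcomp R X) (f.lcomp R X) := by
  refine ⟨lcomp_injective_of_surjective g h.surjective, fun k => ⟨fun hk => ?_, ?_⟩, hX⟩
  · obtain ⟨l, hl⟩ := h.exists_desc k (LinearMap.congr_fun hk)
    exact ⟨l, LinearMap.ext hl⟩
  · rintro ⟨l, rfl⟩
    exact LinearMap.ext fun a => (congrArg l (h.apply_apply a)).trans (map_zero l)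

theorem IsShortExact.compRight_of_exists_lift (h : IsShortExact f g)
    (hX : ∀ d : X →ₗ[R] D, ∃ b : X →ₗ[R] B, g ∘ₗ b = d) :
    IsShortExact (f.compRight R (M := X)) (g.compRight R (M := X)) := by
  refine ⟨fun a b hab => LinearMap.ext fun x => h.injective (LinearMap.congr_fun hab x),
    fun k => ⟨fun hk => ?_, ?_⟩, hX⟩
  · obtain ⟨l, hl⟩ := h.exists_codesc k (LinearMap.congr_fun hk)
    exact ⟨l, LinearMap.ext hl⟩
  · rintro ⟨l, rfl⟩
    exact LinearMap.ext fun x => h.apply_apply (l x)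

theorem IsShortExact.lTensor (h : IsShortExact f g) [Module.Flat R X] :
    IsShortExact (f.lTensor X) (g.lTensor X) :=
  ⟨Module.Flat.lTensor_preserves_injective_linearMap f h.injective,
    _root_.lTensor_exact X h.exact h.surjective, LinearMap.lTensor_surjective X h.surjective⟩

/-- The quotient of a flat module into its double dual is flat. -/
theorem IsShortExact.flat_of_applyₗ [IsNoetherianRing R] [Module.Flat R A]
    {g : DoubleDual R A →ₗ[R] D}
    (h : IsShortExact (LinearMap.applyₗ : A →ₗ[R] DoubleDual R A) g) : Module.Flat R D := by
  apply Module.Flat.of_injective_dual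
  have h' := h.lcomp (E := CharacterModule R)
  let s : (A →ₗ[R] CharacterModule R) →ₗ[R] DoubleDual R A →ₗ[R] CharacterModule R :=
    LinearMap.applyₗ
  obtain ⟨r, hr⟩ := h'.exists_codesc
    (LinearMap.id - s ∘ₗ (LinearMap.applyₗ : A →ₗ[R] DoubleDual R A).lcomp R _) fun x => by
      ext a : 1
      simp [s]
  refine Module.Injective.of_retract (g.lcomp R _) r (fun d => h'.injective ?_)
    (inferInstanceAs (Module.Injective R (DoubleDual R A →ₗ[R] CharacterModule R)))
  rw [hr, LinearMap.sub_apply, LinearMap.comp_apply, h'.apply_apply]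
  simp

end

variable {C F N I E K P X Y : ModuleCat.{u} R}

instance Module.Flat.prod {A B : Type u} [AddCommGroup A] [AddCommGroup B] [Module R A]
    [Module R B] [Module.Flat R A] [Module.Flat R B] : Module.Flat R (A × B) := by
  refine Module.Flat.iff_rTensor_preserves_injective_linearMap.2 fun N N' _ _ _ _ f hf => ?_
  refine Function.Injective.of_comp (f := TensorProduct.prodRight R R N' A B) ?_
  have h : (TensorProduct.prodRight R R N' A B).toLinearMap ∘ₗ f.rTensor (A × B) =
      (f.rTensor A).prodMap (f.rTensor B) ∘ₗ (TensorProduct.prodRight R R N A B).toLinearMap := by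
    ext <;> simp
  have := ((Module.Flat.rTensor_preserves_injective_linearMap (M := A) f hf).prodMap
    (Module.Flat.rTensor_preserves_injective_linearMap (M := B) f hf)).comp
    (TensorProduct.prodRight R R N A B).injective
  convert this
  exact congrArg DFunLike.coe h

theorem rTensor_lTensor_injective {A B F J : Type u} [AddCommGroup A] [AddCommGroup B]
    [AddCommGroup F] [AddCommGroup J] [Module R A] [Module R B] [Module R F] [Module R J]
    [Module.Flat R F] (f : A →ₗ[R] B) (hf : Function.Injective (f.rTensor J)) :
    Function.Injective ((f.lTensor F).rTensor J) := by
  refine Function.Injective.of_comp (f := TensorProduct.assoc R F B J) ?_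
  have := (Module.Flat.lTensor_preserves_injective_linearMap (M := F) _ hf).comp
    (TensorProduct.assoc R F A J).injective
  convert this
  exact congrArg DFunLike.coe (LinearMap.lTensor_rTensor_comp_assoc A f).symm

/-- Tensoring with flat modules preserves orthogonality to the modules `Hom(Hom(C, I), E)`. -/
theorem ExtVanish.tensor_hom [IsNoetherianRing R] [Module.Flat R F] [Module.Finite R N]
    [Module.Injective R I] [Module.Injective R E] (hN : ∀ j, ExtVanish N C (j + 1)) (i : ℕ) :
    ExtVanish (.of R (F ⊗[R] N)) (.of R ((C →ₗ[R] I) →ₗ[R] E)) (i + 1) := by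
  induction i generalizing N with
  | zero =>
    obtain ⟨k, p, hp⟩ := Module.Finite.exists_fin' R N
    have h := isShortExact_ker_subtype p hp
    have hflat : Module.Flat R (ModuleCat.of R (F ⊗[R] (Fin k → R))) :=
      inferInstanceAs (Module.Flat R (F ⊗[R] (Fin k → R)))
    refine IsShortExact.extVanish_one_right (A := .of R (F ⊗[R] LinearMap.ker p))
      (B := .of R (F ⊗[R] (Fin k → R))) (D := .of R (F ⊗[R] N)) h.lTensor
      (.flat_hom (J := .of R (C →ₗ[R] I)) 0) fun a => ?_
    refine exists_extension_of_rTensor_injective _ (rTensor_lTensor_injective _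
      (rTensor_hom_injective _ fun c => ?_)) a
    exact IsShortExact.exists_extension (A := .of R (LinearMap.ker p)) (B := .of R (Fin k → R))
      (D := N) h (hN 0) c
  | succ i ih =>
    obtain ⟨k, p, hp⟩ := Module.Finite.exists_fin' R N
    have h := isShortExact_ker_subtype p hp
    have hflat : Module.Flat R (ModuleCat.of R (F ⊗[R] (Fin k → R))) :=
      inferInstanceAs (Module.Flat R (F ⊗[R] (Fin k → R)))
    have hproj : Module.Projective R (ModuleCat.of R (Fin k → R)) :=
      inferInstanceAs (Module.Projective R (Fin k → R))
    have hfin : Module.Finite R (ModuleCat.of R (LinearMap.ker p)) :=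
      inferInstanceAs (Module.Finite R (LinearMap.ker p))
    refine IsShortExact.extVanish_right (A := .of R (F ⊗[R] LinearMap.ker p))
      (B := .of R (F ⊗[R] (Fin k → R))) (D := .of R (F ⊗[R] N)) h.lTensor
      (ih (N := .of R (LinearMap.ker p)) fun j => ?_) (.flat_hom (J := .of R (C →ₗ[R] I)) (i + 1))
    exact IsShortExact.extVanish_left (A := .of R (LinearMap.ker p)) (B := .of R (Fin k → R))
      (D := N) h .of_projective (hN (j + 1))

theorem InjDimLE.extVanish_hom_hom [IsNoetherianRing R] [Module.Injective R I]
    [Module.Injective R E] {n i : ℕ} (hK : InjDimLE R n K) (hi : n < i) :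
    ExtVanish Y (.of R ((K →ₗ[R] I) →ₗ[R] E)) i := by
  induction n generalizing i K with
  | zero =>
    obtain ⟨i, rfl⟩ : ∃ j, i = j + 1 := ⟨i - 1, by lia⟩
    have : Module.Injective R K := hK
    have : Module.Injective R (ModuleCat.of R ((K →ₗ[R] I) →ₗ[R] E)) :=
      inferInstanceAs (Module.Injective R ((K →ₗ[R] I) →ₗ[R] E))
    exact .of_injective
  | succ n ih =>
    obtain ⟨i, rfl⟩ : ∃ j, i = j + 1 := ⟨i - 1, by lia⟩
    obtain ⟨I', K', h, hI', hK'⟩ := hK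
    obtain ⟨f, g, h'⟩ := (h.hom I).hom E
    have : Module.Injective R (ModuleCat.of R ((I' →ₗ[R] I) →ₗ[R] E)) :=
      inferInstanceAs (Module.Injective R ((I' →ₗ[R] I) →ₗ[R] E))
    exact h'.extVanish_covariant_left (ih hK' (by lia)) .of_injective

/-- `C`-flat modules of injective dimension at most `n` that are right orthogonal to all `C`-flat
modules. -/
structure IsCFlatOrthogonal (C : ModuleCat.{u} R) (n : ℕ) (X : ModuleCat.{u} R) : Prop where
  isCFlat : IsCFlat R C X
  injDim (Y : ModuleCat.{u} R) (i : ℕ) (hi : n < i) : ExtVanish Y X i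
  extVanish (Y : ModuleCat.{u} R) (hY : IsCFlat R C Y) (i : ℕ) : ExtVanish Y X (i + 1)

theorem IsCFlat.congr (e : X ≃ₗ[R] Y) (hX : IsCFlat R C X) : IsCFlat R C Y := by
  obtain ⟨F, hF, ⟨e'⟩⟩ := hX
  exact ⟨F, hF, ⟨e.symm ≪≫ₗ e'⟩⟩

variable {n : ℕ}

theorem IsCFlatOrthogonal.congr (e : X ≃ₗ[R] Y) (hX : IsCFlatOrthogonal C n X) :
    IsCFlatOrthogonal C n Y :=
  ⟨hX.isCFlat.congr e, fun Z i hi => (hX.injDim Z i hi).congr_right e.symm,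
    fun Z hZ i => (hX.extVanish Z hZ i).congr_right e.symm⟩

variable (C n) in
theorem isSelfOrthogonal_isCFlatOrthogonal : IsSelfOrthogonal (IsCFlatOrthogonal C n) n where
  punit := by
    have : Module.Injective R (ModuleCat.of R PUnit.{u + 1}) :=
      ⟨fun _ _ _ _ _ _ f hf g => ⟨0, fun x => Subsingleton.elim (α := PUnit) _ _⟩⟩
    refine ⟨⟨.of R PUnit, inferInstanceAs (Module.Flat R PUnit.{u + 1}), ⟨?_⟩⟩, ?_, ?_⟩
    · exact (0 : PUnit.{u + 1} ≃ₗ[R] PUnit.{u + 1} ⊗[R] C)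
    · intro Y i hi
      obtain ⟨i, rfl⟩ : ∃ j, i = j + 1 := ⟨i - 1, by lia⟩
      exact .of_injective
    · exact fun Y hY i => .of_injective
  prod := by
    rintro X Y hX hY
    obtain ⟨f, g, h⟩ := IsExtension.prod_inl (A := X) (D := Y)
    refine ⟨?_, fun Z i hi => h.extVanish_covariant_middle (hX.injDim Z i hi) (hY.injDim Z i hi),
      fun Z hZ i =>
        h.extVanish_covariant_middle (hX.extVanish Z hZ i) (hY.extVanish Z hZ i)⟩
    obtain ⟨F, hF, ⟨e⟩⟩ := hX.isCFlat
    obtain ⟨F', hF', ⟨e'⟩⟩ := hY.isCFlat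
    exact ⟨.of R (F × F'), inferInstanceAs (Module.Flat R (F × F')),
      ⟨e.prodCongr e' ≪≫ₗ (TensorProduct.prodLeft R R F F' C).symm⟩⟩
  extVanish i hX hY := hY.extVanish _ hX.isCFlat i
  injDim i hY hi := hY.injDim _ i hi

section
variable [IsNoetherianRing R] [Module.Finite R C]

theorem isCFlatOrthogonal_hom_hom (hC : ∀ i, ExtVanish C C (i + 1)) (hn : InjDimLE R n C)
    [Module.Injective R I] [Module.Injective R E] :
    IsCFlatOrthogonal C n (.of R ((C →ₗ[R] I) →ₗ[R] E)) := by
  refine ⟨⟨.of R (I →ₗ[R] E), inferInstanceAs (Module.Flat R (I →ₗ[R] E)),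
    ⟨(LinearEquiv.ofBijective _ (tensorHomEval_bijective (R := R))).symm ≪≫ₗ
      TensorProduct.comm R C (I →ₗ[R] E)⟩⟩, fun Y i hi => hn.extVanish_hom_hom hi, ?_⟩
  rintro Y ⟨F, hF, ⟨e⟩⟩ i
  exact (ExtVanish.tensor_hom hC i).congr_left (B := .of R (F ⊗[R] C)) e

theorem hasCoresolution_hom [Module.Injective R I] [Module.Injective R E]
    (hC : ∀ i, ExtVanish C C (i + 1)) (hn : InjDimLE R n C)
    (hR : Function.Bijective (LinearMap.lsmul R C)) :
    HasCoresolution (IsCFlatOrthogonal C n) (.of R (I →ₗ[R] E)) := by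
  refine ⟨fun H => ∃ N : ModuleCat.{u} R, Module.Finite R N ∧ (∀ i, ExtVanish N C (i + 1)) ∧
    Nonempty (H ≃ₗ[R] (((N →ₗ[R] C) →ₗ[R] I) →ₗ[R] E)), ?_, ?_⟩
  · exact ⟨C, inferInstance, hC, ⟨LinearEquiv.congrLeft E R
      ((LinearMap.ringLmapEquivSelf R R I).symm ≪≫ₗ
        LinearEquiv.congrLeft I R (LinearEquiv.ofBijective _ hR))⟩⟩
  · rintro H ⟨N, hfin, hN, ⟨e⟩⟩
    obtain ⟨k, p, hp⟩ := Module.Finite.exists_fin' R N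
    have h := isShortExact_ker_subtype p hp
    have hproj : Module.Projective R (ModuleCat.of R (Fin k → R)) :=
      inferInstanceAs (Module.Projective R (Fin k → R))
    have h' := ((h.lcomp_of_exists_extension (X := C) (IsShortExact.exists_extension
      (A := .of R (LinearMap.ker p)) (B := .of R (Fin k → R)) (D := N) h (hN 0))).lcomp
      (E := I)).lcomp (E := E)
    refine ⟨.of R ((((Fin k → R) →ₗ[R] C) →ₗ[R] I) →ₗ[R] E),
      .of R (((LinearMap.ker p →ₗ[R] C) →ₗ[R] I) →ₗ[R] E), ?_, ?_, .of R (LinearMap.ker p),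
      inferInstanceAs (Module.Finite R (LinearMap.ker p)), fun j => ?_, ⟨.refl R _⟩⟩
    · have := isCFlatOrthogonal_hom_hom (I := .of R ((Fin k → R) →ₗ[R] I)) (E := E) hC hn
      refine this.congr (LinearEquiv.congrLeft E R (LinearEquiv.symm ?_))
      exact LinearEquiv.congrLeft I R (LinearEquiv.piRing R C (Fin k) R ≪≫ₗ
        (TensorProduct.piScalarRight R R C (Fin k)).symm) ≪≫ₗ
        (TensorProduct.lift.equiv (.id R) C (Fin k → R) I).symm
    · exact IsExtension.congr (A := .of R (((N →ₗ[R] C) →ₗ[R] I) →ₗ[R] E)) ⟨_, _, h'⟩ e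
        (.refl R _) (.refl R _)
    · exact IsShortExact.extVanish_left (A := .of R (LinearMap.ker p)) (B := .of R (Fin k → R))
        (D := N) h .of_projective (hN (j + 1))

theorem hasCoresolution_flat [Module.Flat R F] (hC : ∀ i, ExtVanish C C (i + 1))
    (hn : InjDimLE R n C)
    (hR : Function.Bijective (LinearMap.lsmul R C)) :
    HasCoresolution (IsCFlatOrthogonal C n) F := by
  refine .of_hasCoresolution (isSelfOrthogonal_isCFlatOrthogonal C n)
    ⟨fun F => Module.Flat R F, inferInstance, fun F hF => ?_⟩
  let f : F →ₗ[R] DoubleDual R F := LinearMap.applyₗ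
  have hf : Function.Injective f := by
    rw [injective_iff_map_eq_zero]
    intro x hx
    by_contra h0
    obtain ⟨c, hc⟩ := exists_hom_character_ne_zero (R := R) h0
    exact hc (LinearMap.congr_fun hx c)
  have h := isShortExact_mkQ f hf
  refine ⟨.of R (DoubleDual R F), .of R (DoubleDual R F ⧸ LinearMap.range f), ?_, ⟨_, _, h⟩,
    h.flat_of_applyₗ⟩
  have : Module.Injective R (ModuleCat.of R (F →ₗ[R] CharacterModule R)) :=
    inferInstanceAs (Module.Injective R (F →ₗ[R] CharacterModule R))
  have : Module.Injective R (ModuleCat.of R (CharacterModule R)) :=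
    inferInstanceAs (Module.Injective R (CharacterModule R))
  exact hasCoresolution_hom hC hn hR (I := .of R (F →ₗ[R] CharacterModule R))
    (E := .of R (CharacterModule R))

theorem resDimLE_hom_hom [Module.Injective R E] (hC : ∀ i, ExtVanish C C (i + 1))
    (hn : InjDimLE R n C) {m : ℕ} (hK : InjDimLE R m K)
    (hCK : ∀ i, ExtVanish C K (i + 1)) :
    ResDimLE (HasCoresolution (IsCFlatOrthogonal C n)) m (.of R ((C →ₗ[R] K) →ₗ[R] E)) := by
  have h𝒱 := isSelfOrthogonal_isCFlatOrthogonal C n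
  induction m generalizing K with
  | zero =>
    have : Module.Injective R K := hK
    exact .of_mem h𝒱 (isCFlatOrthogonal_hom_hom hC hn)
  | succ m ih =>
    obtain ⟨I, K', ⟨f, g, h⟩, hI, hK'⟩ := hK
    exact ⟨.of R ((C →ₗ[R] K') →ₗ[R] E), .of R ((C →ₗ[R] I) →ₗ[R] E),
      ⟨_, _, (h.compRight_of_exists_lift (h.exists_lift (hCK 0))).lcomp⟩,
      .of_mem h𝒱 (isCFlatOrthogonal_hom_hom hC hn),
      ih hK' fun i => h.extVanish_covariant_right .of_injective (hCK (i + 1))⟩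

/-- Over a ring with a dualizing module of injective dimension `n`, every module has dimension at
most `n` with respect to the modules coresolved by `C`-flat modules. -/
theorem resDimLE_hasCoresolution (hC : ∀ i, ExtVanish C C (i + 1)) (hn : InjDimLE R n C)
    (hR : Function.Bijective (LinearMap.lsmul R C)) (M : ModuleCat.{u} R) :
    ResDimLE (HasCoresolution (IsCFlatOrthogonal C n)) n M := by
  have h𝒱 := isSelfOrthogonal_isCFlatOrthogonal C n
  refine resDimLE_of_injective h𝒱 (fun P _ => hasCoresolution_flat hC hn hR) (fun E _ => ?_) M
  have e : ((C →ₗ[R] C) →ₗ[R] E) ≃ₗ[R] E :=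
    LinearEquiv.congrLeft E R (LinearEquiv.ofBijective _ hR).symm ≪≫ₗ
      LinearMap.ringLmapEquivSelf R R E
  have h := resDimLE_hom_hom (E := E) hC hn hn hC
  obtain _ | m := n
  · exact .congr h𝒱 e h
  · obtain ⟨K, X, hX, h'⟩ := h
    exact ⟨K, X, hX.congr (.refl R _) (.refl R _) e, h'⟩

end

end

theorem Int.exists_seq {α : Type*} (a : α) (up down : α → α) :
    ∃ K : ℤ → α, K 0 = a ∧ (∀ j, 0 ≤ j → K (j + 1) = up (K j)) ∧
      ∀ j < 0, K j = down (K (j + 1)) := by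
  refine ⟨fun j => if 0 ≤ j then up^[j.toNat] a else down^[(-j).toNat] a, rfl, ?_, ?_⟩
  · intro j hj
    obtain ⟨k, rfl⟩ := Int.eq_ofNat_of_zero_le hj
    simp only [if_pos hj, if_pos (show (0 : ℤ) ≤ k + 1 by lia), Int.toNat_natCast,
      Int.toNat_natCast_add_one, Function.iterate_succ_apply']
  · intro j hj
    obtain ⟨k, rfl⟩ : ∃ k : ℕ, j = -(k + 1 : ℕ) := ⟨(-j - 1).toNat, by lia⟩
    obtain _ | k := k
    · rfl
    · have h : ¬ (0 : ℤ) ≤ -(k + 1 + 1 : ℕ) + 1 := by lia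
      simp only [if_neg hj.not_ge, if_neg h,
        show (-(-((k + 1 + 1 : ℕ) : ℤ))).toNat = k + 1 + 1 by lia,
        show (-(-((k + 1 + 1 : ℕ) : ℤ) + 1)).toNat = k + 1 by lia, Function.iterate_succ_apply']

section
variable {R : Type u} [CommRing R]

theorem Function.Exact.comp_of_injective_of_surjective {A B D E F : Type*} [AddCommGroup A]
    [AddCommGroup B] [AddCommGroup D] [AddCommGroup E] [AddCommGroup F] [Module R A] [Module R B]
    [Module R D] [Module R E] [Module R F] {f : A →ₗ[R] B} {g : B →ₗ[R] D} (h : Function.Exact f g)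
    {p : F →ₗ[R] A} (hp : Function.Surjective p) {i : D →ₗ[R] E} (hi : Function.Injective i) :
    Function.Exact (f ∘ₗ p) (i ∘ₗ g) := fun x => by
  refine (map_eq_zero_iff i hi).trans ((h x).trans ⟨?_, ?_⟩)
  · rintro ⟨y, rfl⟩
    obtain ⟨z, rfl⟩ := hp y
    exact ⟨z, rfl⟩
  · rintro ⟨z, rfl⟩
    exact ⟨p z, rfl⟩

variable {C : ModuleCat.{u} R}

/-- A doubly infinite sequence of extensions splices to a complete `FF_C`-resolution. -/
theorem isGCFlat_of_isExtension {K Z : ℤ → ModuleCat.{u} R}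
    (h : ∀ j, IsExtension (K (j + 1)) (Z j) (K j)) (hflat : ∀ j, 0 ≤ j → Module.Flat R (Z j))
    (hCflat : ∀ j < 0, IsCFlat R C (Z j))
    (hK : ∀ (j : ℤ) (J : ModuleCat.{u} R), IsCInjective R C J →
      ExtVanish (K j) (.of R (CharacterModule J)) 1) : IsGCFlat R C (K 0) := by
  choose f g hfg using h
  refine ⟨⟨Z, fun j => f j ∘ₗ g (j + 1), fun j => ?_⟩, fun j => ?_, hflat, hCflat, ?_, ?_⟩
  · ext x
    exact (congrArg (f j) ((hfg (j + 1)).apply_apply _)).trans (map_zero _)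
  · exact (hfg (j + 1)).exact.comp_of_injective_of_surjective (hfg _).surjective (hfg j).injective
  · intro J hJ j
    have hinj : Function.Injective ((f j).rTensor J) :=
      rTensor_injective_iff_lcomp_surjective.2
        ((hfg j).exists_extension (X := .of R (CharacterModule J)) (hK j J hJ))
    rw [LinearMap.rTensor_comp, LinearMap.rTensor_comp]
    exact (rTensor_exact J (hfg (j + 1)).exact
      (hfg (j + 1)).surjective).comp_of_injective_of_surjective
      (LinearMap.rTensor_surjective J (hfg _).surjective) hinj
  · refine ⟨((Submodule.quotEquivOfEq _ _ ?_).trans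
      ((g 0).quotKerEquivOfSurjective (hfg 0).surjective)).symm⟩
    rw [LinearMap.range_comp, LinearMap.range_eq_top.2 (hfg (0 + 1)).surjective,
      Submodule.map_top]
    exact (hfg 0).exact.linearMap_ker_eq.symm

/-- Modules coresolved by orthogonal `C`-flat modules are `G_C`-flat when `C` is dualizing. -/
theorem HasCoresolution.isGCFlat [IsNoetherianRing R] [Module.Finite R C] {n : ℕ}
    (hC : ∀ i, ExtVanish C C (i + 1)) (hn : InjDimLE R n C)
    (hR : Function.Bijective (LinearMap.lsmul R C)) {G : ModuleCat.{u} R}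
    (hG : HasCoresolution (IsCFlatOrthogonal C n) G) : IsGCFlat R C G := by
  have h𝒱 := isSelfOrthogonal_isCFlatOrthogonal C n
  have hdown (G : {G // HasCoresolution (IsCFlatOrthogonal C n) G}) :
      ∃ Q : {G // HasCoresolution (IsCFlatOrthogonal C n) G}, ∃ X,
        IsExtension G.1 X Q.1 ∧ IsCFlat R C X := by
    obtain ⟨X, Q, hX, h, hQ⟩ := G.2.exists_isExtension
    exact ⟨⟨Q, hQ⟩, X, h, hX.isCFlat⟩
  have hup (G : {G // HasCoresolution (IsCFlatOrthogonal C n) G}) :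
      ∃ K : {G // HasCoresolution (IsCFlatOrthogonal C n) G}, ∃ P,
        IsExtension K.1 P G.1 ∧ Module.Flat R P := by
    obtain ⟨K, P, h, hP⟩ := exists_isExtension_projective G.1
    exact ⟨⟨K, .left h𝒱 h (hasCoresolution_flat hC hn hR) G.2⟩, P, h, inferInstance⟩
  choose up hup using hup
  choose down hdown using hdown
  obtain ⟨K, hK0, hKup, hKdown⟩ := Int.exists_seq ⟨G, hG⟩ up down
  have hZ (j : ℤ) : ∃ Z, IsExtension (K (j + 1)).1 Z (K j).1 ∧ (0 ≤ j → Module.Flat R Z) ∧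
      (j < 0 → IsCFlat R C Z) := by
    rcases le_or_gt 0 j with hj | hj
    · obtain ⟨P, hP, hP'⟩ := hup (K j)
      rw [hKup j hj]
      exact ⟨P, hP, fun _ => hP', fun h => absurd h hj.not_gt⟩
    · obtain ⟨X, hX, hX'⟩ := hdown (K (j + 1))
      rw [hKdown j hj]
      exact ⟨X, hX, fun h => absurd h hj.not_ge, fun _ => hX'⟩
  choose Z hext hflat hCflat using hZ
  have := isGCFlat_of_isExtension (K := fun j => (K j).1) hext hflat hCflat ?_
  · rwa [hK0] at this
  · rintro j J ⟨I, hI, ⟨e⟩⟩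
    have : Module.Injective R (ModuleCat.of R (CharacterModule R)) :=
      inferInstanceAs (Module.Injective R (CharacterModule R))
    exact ((K j).2.extVanish h𝒱 (isCFlatOrthogonal_hom_hom (I := I)
      (E := .of R (CharacterModule R)) hC hn) 0).congr_right
      (Y := .of R ((C →ₗ[R] I) →ₗ[R] CharacterModule R))
      ((CharacterModule.congr e) ≪≫ₗ (homCharacterEquiv _).symm)

end

section
variable {R : Type u} [CommRing R]

section
variable {A B D J : Type u} [AddCommGroup A] [AddCommGroup B] [AddCommGroup D] [AddCommGroup J]
  [Module R A] [Module R B] [Module R D] [Module R J] {f : A →ₗ[R] B} {g : B →ₗ[R] D}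

theorem Function.Exact.isShortExact_liftQ (h : Function.Exact f g) :
    IsShortExact ((LinearMap.range f).liftQ g h.linearMap_ker_eq.ge) (LinearMap.range g).mkQ := by
  refine ⟨?_, ?_, Submodule.mkQ_surjective _⟩
  · rw [← LinearMap.ker_eq_bot, Submodule.ker_liftQ_eq_bot']
    exact h.linearMap_ker_eq.symm
  · rw [LinearMap.exact_iff, Submodule.ker_mkQ, Submodule.range_liftQ]

theorem Function.Exact.rTensor_liftQ_injective (h : Function.Exact f g)
    (hJ : Function.Exact (f.rTensor J) (g.rTensor J)) :
    Function.Injective (((LinearMap.range f).liftQ g h.linearMap_ker_eq.ge).rTensor J) := by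
  rw [injective_iff_map_eq_zero]
  intro x hx
  obtain ⟨y, rfl⟩ := LinearMap.rTensor_surjective J (Submodule.mkQ_surjective _) x
  rw [← LinearMap.comp_apply, ← LinearMap.rTensor_comp, Submodule.liftQ_mkQ] at hx
  obtain ⟨z, rfl⟩ := (hJ y).1 hx
  rw [← LinearMap.comp_apply, ← LinearMap.rTensor_comp, LinearMap.range_mkQ_comp,
    LinearMap.rTensor_zero, LinearMap.zero_apply]

end

variable {C E J K M : ModuleCat.{u} R}

theorem IsGCFlat.congr {M N : ModuleCat.{u} R} (e : M ≃ₗ[R] N) (hM : IsGCFlat R C M) :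
    IsGCFlat R C N := by
  obtain ⟨Z, hZ, h0, h1, hJ, ⟨e'⟩⟩ := hM
  exact ⟨Z, hZ, h0, h1, hJ, ⟨e.symm ≪≫ₗ e'⟩⟩

theorem IsGCFlat.extVanish [Module.Injective R E] (hM : IsGCFlat R C M) (hJ : IsCInjective R C J)
    (i : ℕ) : ExtVanish M (.of R (J →ₗ[R] E)) (i + 1) := by
  obtain ⟨Z, hZ, h0, -, hZJ, ⟨e⟩⟩ := hM
  suffices ∀ j, 0 ≤ j → ExtVanish (.of R (Z.X j ⧸ LinearMap.range (Z.d j)))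
    (.of R (J →ₗ[R] E)) (i + 1) from
    (this 0 le_rfl).congr_left (B := .of R (Z.X 0 ⧸ LinearMap.range (Z.d 0))) e
  induction i with
  | zero =>
    intro j hj
    have := h0 j hj
    refine IsShortExact.extVanish_one_right
      (A := .of R (Z.X (j + 1) ⧸ LinearMap.range (Z.d (j + 1)))) (B := Z.X j)
      (D := .of R (Z.X j ⧸ LinearMap.range (Z.d j))) (hZ j).isShortExact_liftQ (.flat_hom 0) ?_
    exact exists_extension_of_rTensor_injective _ ((hZ j).rTensor_liftQ_injective (hZJ J hJ j))
  | succ i ih =>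
    intro j hj
    have := h0 j hj
    exact IsShortExact.extVanish_right
      (A := .of R (Z.X (j + 1) ⧸ LinearMap.range (Z.d (j + 1)))) (B := Z.X j)
      (D := .of R (Z.X j ⧸ LinearMap.range (Z.d j))) (hZ j).isShortExact_liftQ
      (ih (j + 1) (by lia)) (.flat_hom (i + 1))

theorem ResDimLE.extVanish [Module.Injective R E] {n i : ℕ} (hM : ResDimLE (IsGCFlat R C) n M)
    (hJ : IsCInjective R C J) (hi : n < i) : ExtVanish M (.of R (J →ₗ[R] E)) i := by
  obtain ⟨i, rfl⟩ : ∃ j, i = j + 1 := ⟨i - 1, by lia⟩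
  induction n generalizing i M with
  | zero => exact IsGCFlat.extVanish hM hJ i
  | succ n ih =>
    obtain ⟨K, X, ⟨f, g, h⟩, hX, hK⟩ := hM
    obtain ⟨i, rfl⟩ : ∃ j, i = j + 1 := ⟨i - 1, by lia⟩
    exact h.extVanish_right (ih hK i (by lia)) (hX.extVanish hJ (i + 1))

theorem ResDimLE.mono {𝒳 𝒴 : ModuleCat.{u} R → Prop} (h : ∀ M, 𝒳 M → 𝒴 M) {n : ℕ}
    (hM : ResDimLE 𝒳 n M) : ResDimLE 𝒴 n M := by
  induction n generalizing M with
  | zero => exact h M hM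
  | succ n ih =>
    obtain ⟨K, X, hKX, hX, hK⟩ := hM
    exact ⟨K, X, hKX, h X hX, ih hK⟩

/-- The injective dimension is detected by cyclic modules and the double dual. -/
theorem InjDimLE.of_doubleDual [IsNoetherianRing R] {n : ℕ}
    (h : ∀ I : Ideal R, ExtVanish (.of R (R ⧸ I)) (.of R (DoubleDual R K)) (n + 1)) :
    InjDimLE R n K := by
  induction n generalizing K with
  | zero =>
    refine Module.Injective.of_doubleDual (Module.Baer.iff_surjective.2 fun I => ?_).injective
    have hI := isShortExact_mkQ I.subtype I.injective_subtype
    rw [I.range_subtype] at hI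
    exact IsShortExact.exists_extension (A := .of R I) (B := .of R R) (D := .of R (R ⧸ I))
      (X := .of R (DoubleDual R K)) hI (h I)
  | succ n ih =>
    obtain ⟨E, K', ⟨f, g, hfg⟩, hE⟩ := exists_isExtension_injective K
    refine ⟨E, K', ⟨f, g, hfg⟩, hE, ih fun I => ?_⟩
    have : Module.Injective R (ModuleCat.of R (DoubleDual R E)) :=
      inferInstanceAs (Module.Injective R (DoubleDual R E))
    exact IsShortExact.extVanish_covariant_right (A := .of R (DoubleDual R K))
      (B := .of R (DoubleDual R E)) (D := .of R (DoubleDual R K')) hfg.lcomp.lcomp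
      .of_injective (h I)

end

/-- If `R` is noetherian of finite Krull dimension and `C` is
semidualizing, then every `R`-module has finite `G_C`-flat dimension iff `C` is
dualizing (i.e. `C` has finite injective dimension). -/
theorem stmt7 (R : Type u) [CommRing R] [IsNoetherianRing R]
    (hdim : ringKrullDim R < ⊤)
    (C : ModuleCat.{u} R) (hC : IsSemidualizing R C) :
    (∀ M : ModuleCat.{u} R, ∃ n, HasResOfLength R (IsGCFlat R C) n M) ↔
      (∃ n, HasCoresOfLength R (fun I => Module.Injective R ↥I) n C) := by
  obtain ⟨hfin, hR, hCC⟩ := hC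
  constructor
  · intro h
    obtain ⟨n, hn⟩ := h (.of R (∀ I : Ideal R, R ⧸ I))
    have hM := hn.resDimLE fun A B e => IsGCFlat.congr e
    have : Module.Injective R (ModuleCat.of R (CharacterModule R)) :=
      inferInstanceAs (Module.Injective R (CharacterModule R))
    refine ⟨n, (InjDimLE.of_doubleDual fun I => ?_).hasCoresOfLength⟩
    have hJ : IsCInjective R C (.of R (C →ₗ[R] CharacterModule R)) :=
      ⟨.of R (CharacterModule R), this, ⟨.refl R _⟩⟩
    classical
    exact (hM.extVanish (E := .of R (CharacterModule R)) hJ n.lt_succ_self).of_retract_left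
      (A := .of R (R ⧸ I)) (B := .of R (∀ I : Ideal R, R ⧸ I))
      (LinearMap.single R (fun I : Ideal R => R ⧸ I) I) (LinearMap.proj I)
      (LinearMap.proj_comp_single_same R _ I)
  · rintro ⟨n, hn⟩ M
    have hn := hn.injDimLE
    have hext := extZero.extVanish hCC
    exact ⟨n, ((resDimLE_hasCoresolution hext hn hR M).mono fun G hG =>
      hG.isGCFlat hext hn hR).hasResOfLength⟩
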